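/- Let λ = [E⁺ : E_q⁺], and let C, D be integers with 0 ≤ C, D ≤ q−1, not both zero. Let R be a set of representatives of the orbits of E_q⁺ acting by multiplication on ((C + Dδ)/q + 𝔟⁻¹)⁺, the set of totally positive elements of the coset (C + Dδ)/q + 𝔟⁻¹. Then the series Z(s) = Σ_{α∈R} N(α)^{−s} converges absolutely for Re(s) > 1, and every function F analytic on a connected open set U ⊆ ℂ containing {s : Re(s) > 1} ∪ {0} and agreeing with Z on {s : Re(s) > 1} satisfies F(0) = Σ_{i=1}^{λm} [ B₁(x^i_{C+Dδ})·B₁(y^i_{C+Dδ}) + (b_i/2)·B₂(x^i_{C+Dδ}) ]. -/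

import Mathlib

open NumberField FractionalIdeal
open scoped nonZeroDivisors

/-- The first Bernoulli polynomial `B₁(x) = x - 1/2`. -/
noncomputable def B1 (x : ℝ) : ℝ := x - 1/2

/-- The second Bernoulli polynomial `B₂(x) = x² - x + 1/6`. -/
noncomputable def B2 (x : ℝ) : ℝ := x^2 - x + 1/6

namespace ConeZeta

section

open MeasureTheory Set Filter Topology

/-- `f` is continuous on `[0, ∞) × [0, 1]` and is `O(exp (-c r))` there. -/
structure ExpBdd (c : ℝ) (f : ℝ → ℝ → ℝ) : Prop where
  cont : ContinuousOn (fun p : ℝ × ℝ => f p.1 p.2) (Ici 0 ×ˢ Icc 0 1)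
  bdd : ∃ C, ∀ r v, 0 ≤ r → 0 ≤ v → v ≤ 1 → |f r v| ≤ C * Real.exp (-c * r)

/-- `fr` and `fv` are the partial derivatives of `f` on `[0, ∞) × [0, 1]`. -/
structure HasPartials (f fr fv : ℝ → ℝ → ℝ) : Prop where
  left : ∀ r v, 0 ≤ r → 0 ≤ v → v ≤ 1 → HasDerivAt (fun t => f t v) (fr r v) r
  right : ∀ r v, 0 ≤ r → 0 ≤ v → v ≤ 1 → HasDerivAt (fun t => f r t) (fv r v) v

/-- All partial derivatives of `f` up to order `n` are `O(exp (-c r))` on `[0, ∞) × [0, 1]`. -/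
def SmoothExp : ℕ → ℝ → (ℝ → ℝ → ℝ) → Prop
  | 0, c, f => ExpBdd c f
  | n + 1, c, f => ExpBdd c f ∧ ∃ fr fv, HasPartials f fr fv ∧ SmoothExp n c fr ∧ SmoothExp n c fv

theorem ExpBdd.add {c : ℝ} {f g : ℝ → ℝ → ℝ} (hf : ExpBdd c f) (hg : ExpBdd c g) :
    ExpBdd c (fun r v => f r v + g r v) := by
  refine ⟨hf.cont.add hg.cont, ?_⟩
  obtain ⟨C, hC⟩ := hf.bdd
  obtain ⟨C', hC'⟩ := hg.bdd
  refine ⟨C + C', fun r v hr h0 h1 => ?_⟩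
  have := abs_add_le (f r v) (g r v)
  have := hC r v hr h0 h1
  have := hC' r v hr h0 h1
  linarith

theorem ExpBdd.mul {c d : ℝ} {f g : ℝ → ℝ → ℝ} (hf : ExpBdd c f) (hg : ExpBdd d g) :
    ExpBdd (c + d) (fun r v => f r v * g r v) := by
  refine ⟨hf.cont.mul hg.cont, ?_⟩
  obtain ⟨C, hC⟩ := hf.bdd
  obtain ⟨C', hC'⟩ := hg.bdd
  refine ⟨C * C', fun r v hr h0 h1 => ?_⟩
  have h2 := hC r v hr h0 h1
  have h3 := hC' r v hr h0 h1
  rw [abs_mul]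
  calc |f r v| * |g r v| ≤ (C * Real.exp (-c * r)) * (C' * Real.exp (-d * r)) :=
        mul_le_mul h2 h3 (abs_nonneg _) ((abs_nonneg _).trans h2)
    _ = C * C' * Real.exp (-(c + d) * r) := by
        rw [show -(c + d) * r = -c * r + -d * r by ring, Real.exp_add]; ring

theorem ExpBdd.mono {c d : ℝ} {f : ℝ → ℝ → ℝ} (hf : ExpBdd c f) (h : d ≤ c) : ExpBdd d f := by
  refine ⟨hf.cont, ?_⟩
  obtain ⟨C, hC⟩ := hf.bdd
  refine ⟨C, fun r v hr h0 h1 => (hC r v hr h0 h1).trans ?_⟩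
  have hC0 : 0 ≤ C := by
    have := (abs_nonneg _).trans (hC 0 0 le_rfl le_rfl zero_le_one)
    simpa using this
  gcongr

theorem SmoothExp.expBdd {n : ℕ} {c : ℝ} {f : ℝ → ℝ → ℝ} (hf : SmoothExp n c f) :
    ExpBdd c f := by
  cases n with
  | zero => exact hf
  | succ n => exact hf.1

theorem SmoothExp.of_succ {n : ℕ} {c : ℝ} {f : ℝ → ℝ → ℝ} (hf : SmoothExp (n + 1) c f) :
    SmoothExp n c f := by
  induction n generalizing f with
  | zero => exact hf.1
  | succ n ih =>
    obtain ⟨h0, fr, fv, hp, hr, hv⟩ := hf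
    exact ⟨h0, fr, fv, hp, ih hr, ih hv⟩

theorem SmoothExp.mono {n : ℕ} {c d : ℝ} {f : ℝ → ℝ → ℝ} (hf : SmoothExp n c f) (h : d ≤ c) :
    SmoothExp n d f := by
  induction n generalizing f with
  | zero => exact ExpBdd.mono hf h
  | succ n ih =>
    obtain ⟨h0, fr, fv, hp, hr, hv⟩ := hf
    exact ⟨h0.mono h, fr, fv, hp, ih hr, ih hv⟩

theorem SmoothExp.add {n : ℕ} {c : ℝ} {f g : ℝ → ℝ → ℝ} (hf : SmoothExp n c f)
    (hg : SmoothExp n c g) : SmoothExp n c (fun r v => f r v + g r v) := by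
  induction n generalizing f g with
  | zero => exact ExpBdd.add hf hg
  | succ n ih =>
    obtain ⟨h0, fr, fv, hp, hr, hv⟩ := hf
    obtain ⟨h0', gr, gv, hp', hr', hv'⟩ := hg
    exact ⟨h0.add h0', _, _,
      ⟨fun r v a b d => (hp.left r v a b d).add (hp'.left r v a b d),
       fun r v a b d => (hp.right r v a b d).add (hp'.right r v a b d)⟩, ih hr hr', ih hv hv'⟩

theorem SmoothExp.mul {n : ℕ} {c d : ℝ} {f g : ℝ → ℝ → ℝ} (hf : SmoothExp n c f)
    (hg : SmoothExp n d g) : SmoothExp n (c + d) (fun r v => f r v * g r v) := by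
  induction n generalizing f g with
  | zero => exact ExpBdd.mul hf hg
  | succ n ih =>
    have hf1 := hf.of_succ
    have hg1 := hg.of_succ
    obtain ⟨h0, fr, fv, hp, hr, hv⟩ := hf
    obtain ⟨h0', gr, gv, hp', hr', hv'⟩ := hg
    exact ⟨h0.mul h0', _, _,
      ⟨fun r v a b d => (hp.left r v a b d).mul (hp'.left r v a b d),
       fun r v a b d => (hp.right r v a b d).mul (hp'.right r v a b d)⟩,
       (ih hr hg1).add (ih hf1 hr'), (ih hv hg1).add (ih hf1 hv')⟩

/-- All partial derivatives of `f` grow subexponentially in `r`. -/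
def Moderate (f : ℝ → ℝ → ℝ) : Prop := ∀ n : ℕ, ∀ η > 0, SmoothExp n (-η) f

theorem SmoothExp.mul_moderate {n : ℕ} {c d : ℝ} {f g : ℝ → ℝ → ℝ} (hf : SmoothExp n c f)
    (hg : Moderate g) (h : d < c) : SmoothExp n d (fun r v => f r v * g r v) := by
  have := hf.mul (hg n (c - d) (by linarith))
  exact this.mono (by linarith)

theorem Moderate.add {f g : ℝ → ℝ → ℝ} (hf : Moderate f) (hg : Moderate g) :
    Moderate (fun r v => f r v + g r v) :=
  fun n η h => (hf n η h).add (hg n η h)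

theorem Moderate.mul {f g : ℝ → ℝ → ℝ} (hf : Moderate f) (hg : Moderate g) :
    Moderate (fun r v => f r v * g r v) :=
  fun n η h => (hf n (η / 2) (by linarith)).mul_moderate hg (by linarith)

theorem ExpBdd.of_le {η : ℝ} {f : ℝ → ℝ → ℝ} (hη : 0 < η)
    (hc : ContinuousOn (fun p : ℝ × ℝ => f p.1 p.2) (Ici 0 ×ˢ Icc 0 1))
    {B : ℝ} (hb : ∀ r v, 0 ≤ r → 0 ≤ v → v ≤ 1 → |f r v| ≤ B * (1 + r)) : ExpBdd (-η) f := by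
  have hB : 0 ≤ B := by
    have := (abs_nonneg _).trans (hb 0 0 le_rfl le_rfl zero_le_one)
    simpa using this
  refine ⟨hc, B * (1 + 1 / η), fun r v hr h0 h1 => (hb r v hr h0 h1).trans ?_⟩
  rw [mul_assoc]
  refine mul_le_mul_of_nonneg_left ?_ hB
  have h2 := Real.add_one_le_exp (η * r)
  have h3 : 1 ≤ Real.exp (η * r) := Real.one_le_exp (by positivity)
  have h4 : r ≤ 1 / η * Real.exp (η * r) := by
    rw [one_div, inv_mul_eq_div, le_div_iff₀ hη]; linarith
  rw [neg_neg, add_mul]; linarith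

theorem moderate_const (a : ℝ) : Moderate (fun _ _ => a) := by
  have h0 : ∀ a : ℝ, ∀ η > 0, ExpBdd (-η) (fun _ _ => a) := fun a η h =>
    ExpBdd.of_le h continuousOn_const (B := |a|)
      fun r v hr _ _ => le_mul_of_one_le_right (abs_nonneg a) (by linarith)
  intro n
  induction n generalizing a with
  | zero => exact h0 a
  | succ n ih =>
    exact fun η h => ⟨h0 a η h, _, _, ⟨fun r v _ _ _ => hasDerivAt_const r a,
      fun r v _ _ _ => hasDerivAt_const v a⟩, ih 0 η h, ih 0 η h⟩

theorem moderate_fst : Moderate (fun r _ => r) := by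
  have h0 : ∀ η > 0, ExpBdd (-η) (fun r _ => r) := fun η h =>
    ExpBdd.of_le h continuousOn_fst (B := 1)
      fun r v hr _ _ => by rw [abs_of_nonneg hr]; linarith
  intro n η h
  cases n with
  | zero => exact h0 η h
  | succ n =>
    exact ⟨h0 η h, _, _, ⟨fun r v _ _ _ => hasDerivAt_id r,
      fun r v _ _ _ => hasDerivAt_const v r⟩, moderate_const 1 n η h, moderate_const 0 n η h⟩

theorem moderate_snd : Moderate (fun _ v => v) := by
  have h0 : ∀ η > 0, ExpBdd (-η) (fun _ v => v) := fun η h =>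
    ExpBdd.of_le h continuousOn_snd (B := 1)
      fun r v hr h0 h1 => by rw [abs_of_nonneg h0]; linarith
  intro n η h
  cases n with
  | zero => exact h0 η h
  | succ n =>
    exact ⟨h0 η h, _, _, ⟨fun r v _ _ _ => hasDerivAt_const r v,
      fun r v _ _ _ => hasDerivAt_id v⟩, moderate_const 0 n η h, moderate_const 1 n η h⟩

/-- The affine interpolation between `a'` and `a`. -/
def lin (a a' v : ℝ) : ℝ := v * a + (1 - v) * a'

theorem lin_pos {a a' v : ℝ} (ha : 0 < a) (ha' : 0 < a') (h0 : 0 ≤ v) (h1 : v ≤ 1) :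
    0 < lin a a' v := by
  unfold lin
  rcases h0.eq_or_lt with rfl | h
  · simpa using ha'
  · have : 0 ≤ (1 - v) * a' := mul_nonneg (by linarith) ha'.le
    have := mul_pos h ha
    linarith

theorem min_le_lin {a a' v : ℝ} (h0 : 0 ≤ v) (h1 : v ≤ 1) : min a a' ≤ lin a a' v := by
  unfold lin
  have h2 := mul_le_mul_of_nonneg_left (min_le_left a a') h0
  have h3 := mul_le_mul_of_nonneg_left (min_le_right a a') (sub_nonneg.2 h1)
  linarith

theorem lin_le_add {a a' v : ℝ} (ha : 0 < a) (ha' : 0 < a') (h0 : 0 ≤ v) (h1 : v ≤ 1) :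
    lin a a' v ≤ a + a' := by
  unfold lin
  nlinarith

theorem hasDerivAt_lin (a a' v : ℝ) : HasDerivAt (lin a a') (a - a') v := by
  have := ((hasDerivAt_id v).mul_const a).add (((hasDerivAt_id v).const_sub 1).mul_const a')
  convert this using 1 <;> first | rfl | ring

theorem continuous_lin (a a' : ℝ) : Continuous (lin a a') := by
  unfold lin; fun_prop

theorem moderate_lin (a a' : ℝ) : Moderate (fun _ v => lin a a' v) := by
  have h : (fun _ v : ℝ => lin a a' v) =
      (fun _ v : ℝ => v * (a - a') + a') := by
    funext r v; unfold lin; ring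
  rw [h]
  exact (moderate_snd.mul (moderate_const _)).add (moderate_const _)

theorem Moderate.inv {f : ℝ → ℝ → ℝ} (hf : Moderate f)
    (hne : ∀ r v, 0 ≤ r → 0 ≤ v → v ≤ 1 → f r v ≠ 0) {B : ℝ}
    (hb : ∀ r v, 0 ≤ r → 0 ≤ v → v ≤ 1 → |(f r v)⁻¹| ≤ B * (1 + r)) :
    Moderate (fun r v => (f r v)⁻¹) := by
  have h0 : ∀ η > 0, ExpBdd (-η) (fun r v => (f r v)⁻¹) := fun η h =>
    ExpBdd.of_le h ((hf 0 1 one_pos).cont.inv₀ fun p hp => hne _ _ hp.1 hp.2.1 hp.2.2) hb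
  intro n
  induction n with
  | zero => exact h0
  | succ n ih =>
    intro η h
    obtain ⟨_, fr, fv, hp, hr, hv⟩ := hf (n + 1) (η / 3) (by linarith)
    have key : ∀ g, SmoothExp n (-(η / 3)) g →
        SmoothExp n (-η) (fun r v => -1 * (g r v) * ((f r v)⁻¹ * (f r v)⁻¹)) := by
      intro g hg
      have h1 := ((moderate_const (-1)) n (η / 3 / 2) (by linarith)).mul hg
      have h2 := (ih (η / 4) (by linarith)).mul (ih (η / 4) (by linarith))
      have h3 := h1.mul h2
      exact h3.mono (by linarith)
    refine ⟨h0 η h, _, _, ⟨fun r v a b c => ?_, fun r v a b c => ?_⟩, key _ hr, key _ hv⟩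
    · exact ((hp.left r v a b c).fun_inv (hne r v a b c)).congr_deriv (by field_simp)
    · exact ((hp.right r v a b c).fun_inv (hne r v a b c)).congr_deriv (by field_simp)

theorem moderate_inv_lin {a a' : ℝ} (ha : 0 < a) (ha' : 0 < a') :
    Moderate (fun _ v => (lin a a' v)⁻¹) := by
  refine (moderate_lin a a').inv (fun r v _ h0 h1 => (lin_pos ha ha' h0 h1).ne')
    (B := (min a a')⁻¹) fun r v hr h0 h1 => ?_
  have hm : 0 < min a a' := lt_min ha ha'
  rw [abs_of_pos (inv_pos.2 (lin_pos ha ha' h0 h1))]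
  calc (lin a a' v)⁻¹ ≤ (min a a')⁻¹ := inv_anti₀ hm (min_le_lin h0 h1)
    _ ≤ (min a a')⁻¹ * (1 + r) := le_mul_of_one_le_right (by positivity) (by linarith)

theorem smoothExp_exp {a a' x : ℝ} (hx : 0 ≤ x) (n : ℕ) {c : ℝ}
    (hc : c < x * min a a') : SmoothExp n c (fun r v => Real.exp (-x * (r * lin a a' v))) := by
  have hcont := continuous_lin a a'
  have h0 : ∀ c, c < x * min a a' →
      ExpBdd c (fun r v => Real.exp (-x * (r * lin a a' v))) := by
    intro c hc
    refine ⟨by fun_prop, 1, fun r v hr h0 h1 => ?_⟩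
    rw [Real.abs_exp, one_mul, Real.exp_le_exp]
    have h2 := mul_le_mul_of_nonneg_left (min_le_lin (a := a) (a' := a') h0 h1)
      (mul_nonneg hx hr)
    nlinarith
  induction n generalizing c with
  | zero => exact h0 c hc
  | succ n ih =>
    obtain ⟨d, hd, hd'⟩ := exists_between hc
    refine ⟨h0 c hc, _, _, ⟨fun r v _ _ _ => ?_, fun r v _ _ _ => ?_⟩,
      (ih hd').mul_moderate ((moderate_const (-x)).mul (moderate_lin a a')) hd,
      (ih hd').mul_moderate ((moderate_const (-x)).mul
        (moderate_fst.mul (moderate_const (a - a')))) hd⟩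
    · exact (((hasDerivAt_id' r).mul_const (lin a a' v)).const_mul (-x)).exp.congr_deriv (by simp)
    · exact (((hasDerivAt_lin a a' v).const_mul r).const_mul (-x)).exp

/-- The moments `∫₀¹ sᵐ exp (-ts) ds`. -/
noncomputable def phi (m : ℕ) (t : ℝ) : ℝ := ∫ s in (0:ℝ)..1, s ^ m * Real.exp (-t * s)

theorem hasDerivAt_phi (m : ℕ) (t : ℝ) : HasDerivAt (phi m) (-phi (m + 1) t) t := by
  unfold phi
  rw [← intervalIntegral.integral_neg]
  refine (intervalIntegral.hasDerivAt_integral_of_dominated_loc_of_deriv_le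
    (F := fun t s => s ^ m * Real.exp (-t * s))
    (F' := fun t s => -(s ^ (m + 1) * Real.exp (-t * s)))
    (bound := fun _ => Real.exp (|t| + 1)) (s := Metric.ball t 1)
    (Metric.ball_mem_nhds t one_pos) ?_ ?_ ?_ ?_ ?_ ?_).2
  · exact Eventually.of_forall fun u => (by fun_prop : Continuous _).aestronglyMeasurable
  · exact (by fun_prop : Continuous _).intervalIntegrable _ _
  · exact (by fun_prop : Continuous _).aestronglyMeasurable
  · refine Eventually.of_forall fun s hs u hu => ?_
    rw [uIoc_of_le zero_le_one] at hs
    rw [norm_neg, norm_mul, Real.norm_eq_abs, Real.norm_eq_abs, Real.abs_exp,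
      abs_of_nonneg (pow_nonneg hs.1.le _)]
    have hu' : |u| ≤ |t| + 1 := by
      have h1 : |u - t| < 1 := by simpa [Real.dist_eq] using hu
      have h2 := abs_sub_abs_le_abs_sub u t
      linarith
    have h3 : -u * s ≤ |t| + 1 := by
      calc -u * s ≤ |u| * s := mul_le_mul_of_nonneg_right (neg_le_abs u) hs.1.le
        _ ≤ |u| * 1 := mul_le_mul_of_nonneg_left hs.2 (abs_nonneg u)
        _ ≤ _ := by linarith
    calc s ^ (m + 1) * Real.exp (-u * s) ≤ 1 * Real.exp (|t| + 1) :=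
          mul_le_mul (pow_le_one₀ hs.1.le hs.2) (Real.exp_le_exp.2 h3) (Real.exp_pos _).le
            zero_le_one
      _ = _ := one_mul _
  · exact intervalIntegrable_const
  · refine Eventually.of_forall fun s hs u hu => ?_
    exact ((((hasDerivAt_id' u).fun_neg.mul_const s).exp).const_mul (s ^ m)).congr_deriv (by ring)

theorem continuous_phi (m : ℕ) : Continuous (phi m) :=
  continuous_iff_continuousAt.2 fun t => (hasDerivAt_phi m t).continuousAt

theorem abs_phi_le (m : ℕ) {t : ℝ} (ht : 0 ≤ t) : |phi m t| ≤ 1 := by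
  have := intervalIntegral.norm_integral_le_of_norm_le_const (a := 0) (b := 1) (C := 1)
    (f := fun s => s ^ m * Real.exp (-t * s)) (fun s hs => ?_)
  · simpa [phi] using this
  · rw [uIoc_of_le zero_le_one] at hs
    rw [norm_mul, Real.norm_eq_abs, Real.norm_eq_abs, Real.abs_exp,
      abs_of_nonneg (pow_nonneg hs.1.le _)]
    refine mul_le_one₀ (pow_le_one₀ hs.1.le hs.2) (Real.exp_pos _).le ?_
    rw [Real.exp_le_one_iff]
    nlinarith [hs.1]

theorem phi_apply_zero (m : ℕ) : phi m 0 = 1 / (m + 1) := by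
  simp [phi, integral_pow]

theorem phi_zero_of_ne {t : ℝ} (ht : t ≠ 0) : phi 0 t = (1 - Real.exp (-t)) / t := by
  have h : ∀ s ∈ uIcc (0:ℝ) 1, HasDerivAt (fun s => -Real.exp (-t * s) / t)
      (s ^ 0 * Real.exp (-t * s)) s := by
    intro s _
    exact ((((hasDerivAt_id' s).const_mul (-t)).exp).fun_neg.div_const t).congr_deriv
      (by field_simp)
  rw [phi, intervalIntegral.integral_eq_sub_of_hasDerivAt h
    ((by fun_prop : Continuous _).intervalIntegrable _ _)]
  simp; ring

theorem inv_le_phi_zero {t : ℝ} (ht : 0 ≤ t) : (1 + t)⁻¹ ≤ phi 0 t := by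
  rcases ht.eq_or_lt with rfl | h
  · simp [phi_apply_zero]
  · rw [phi_zero_of_ne h.ne', le_div_iff₀ h]
    have h1 : Real.exp (-t) ≤ (1 + t)⁻¹ := by
      rw [Real.exp_neg]
      exact inv_anti₀ (by linarith) (by linarith [Real.add_one_le_exp t])
    have h2 : (1 + t)⁻¹ * t = 1 - (1 + t)⁻¹ := by field_simp; ring
    linarith

theorem phi_zero_pos {t : ℝ} (ht : 0 ≤ t) : 0 < phi 0 t :=
  lt_of_lt_of_le (by positivity) (inv_le_phi_zero ht)

theorem moderate_phi {a a' : ℝ} (ha : 0 < a) (ha' : 0 < a') (m : ℕ) :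
    Moderate (fun r v => phi m (r * lin a a' v)) := by
  have hl := continuous_lin a a'
  have h0 : ∀ m, ∀ η > 0, ExpBdd (-η) (fun r v => phi m (r * lin a a' v)) := by
    intro m η h
    have hp := continuous_phi m
    refine ExpBdd.of_le h (by fun_prop) (B := 1) fun r v hr h0 h1 => ?_
    have := abs_phi_le m (mul_nonneg hr (lin_pos ha ha' h0 h1).le)
    linarith
  intro n
  induction n generalizing m with
  | zero => exact h0 m
  | succ n ih =>
    intro η h
    have key : ∀ g, Moderate g →
        SmoothExp n (-η) (fun r v => phi (m + 1) (r * lin a a' v) * g r v) := fun g hg =>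
      (ih (m + 1) (η / 2) (by linarith)).mul_moderate hg (by linarith)
    refine ⟨h0 m η h, _, _, ⟨fun r v _ _ _ => ?_, fun r v _ _ _ => ?_⟩,
      key _ ((moderate_const (-1)).mul (moderate_lin a a')),
      key _ ((moderate_const (-1)).mul (moderate_fst.mul (moderate_const (a - a'))))⟩
    · exact ((hasDerivAt_phi m _).comp r ((hasDerivAt_id' r).mul_const (lin a a' v))).congr_deriv
        (by ring)
    · exact ((hasDerivAt_phi m _).comp v ((hasDerivAt_lin a a' v).const_mul r)).congr_deriv
        (by ring)

theorem moderate_inv_phi {a a' : ℝ} (ha : 0 < a) (ha' : 0 < a') :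
    Moderate (fun r v => (phi 0 (r * lin a a' v))⁻¹) := by
  have hp : ∀ r v, 0 ≤ r → 0 ≤ v → v ≤ 1 → 0 ≤ r * lin a a' v := fun r v hr h0 h1 =>
    mul_nonneg hr (lin_pos ha ha' h0 h1).le
  refine (moderate_phi ha ha' 0).inv (fun r v hr h0 h1 => (phi_zero_pos (hp r v hr h0 h1)).ne')
    (B := 1 + (a + a')) fun r v hr h0 h1 => ?_
  have h2 := hp r v hr h0 h1
  rw [abs_of_pos (inv_pos.2 (phi_zero_pos h2))]
  calc (phi 0 (r * lin a a' v))⁻¹ ≤ ((1 + r * lin a a' v)⁻¹)⁻¹ :=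
        inv_anti₀ (by positivity) (inv_le_phi_zero h2)
    _ = 1 + r * lin a a' v := inv_inv _
    _ ≤ 1 + r * (a + a') := by
        have := mul_le_mul_of_nonneg_left (lin_le_add ha ha' h0 h1) hr
        linarith
    _ ≤ (1 + (a + a')) * (1 + r) := by nlinarith

/-- The generating function of a cone, multiplied by `r ^ 2`. -/
noncomputable def gen (a a' d d' x y : ℝ) (r v : ℝ) : ℝ :=
  Real.exp (-x * (r * lin a a' v)) * (Real.exp (-y * (r * lin d d' v)) *
    ((phi 0 (r * lin a a' v))⁻¹ * (phi 0 (r * lin d d' v))⁻¹ *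
      ((lin a a' v)⁻¹ * (lin d d' v)⁻¹)))

theorem smoothExp_gen {a a' d d' x y : ℝ} (ha : 0 < a) (ha' : 0 < a') (hd : 0 < d)
    (hd' : 0 < d') (hx : 0 < x) (hy : 0 ≤ y) :
    ∃ c > 0, ∀ n, SmoothExp n c (gen a a' d d' x y) := by
  have hm : 0 < min a a' := lt_min ha ha'
  have hm' : 0 < min d d' := lt_min hd hd'
  have hc : 0 < x * min a a' := mul_pos hx hm
  refine ⟨x * min a a' / 4, by linarith, fun n => ?_⟩
  have h1 := smoothExp_exp (a := a) (a' := a') hx.le n (c := x * min a a' / 2) (by linarith)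
  have h2 : Moderate (fun r v => Real.exp (-y * (r * lin d d' v))) := fun n η hη =>
    smoothExp_exp hy n (lt_of_lt_of_le (neg_lt_zero.2 hη) (by positivity))
  exact h1.mul_moderate (h2.mul (((moderate_inv_phi ha ha').mul (moderate_inv_phi hd hd')).mul
    ((moderate_inv_lin ha ha').mul (moderate_inv_lin hd hd')))) (by linarith)

/-- The open strip `(0, ∞) × (0, 1)`. -/
def strip : Set (ℝ × ℝ) := Ioi 0 ×ˢ Ioo 0 1

theorem measurableSet_strip : MeasurableSet strip := measurableSet_Ioi.prod measurableSet_Ioo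

theorem volume_restrict_strip : (volume : Measure (ℝ × ℝ)).restrict strip =
    ((volume : Measure ℝ).restrict (Ioi 0)).prod ((volume : Measure ℝ).restrict (Ioo 0 1)) := by
  rw [Measure.prod_restrict, ← Measure.volume_eq_prod]; rfl

/-- The kernel `(v (1 - v)) ^ (a - 1) * r ^ (w - 1)`. -/
noncomputable def ker (a w : ℂ) (p : ℝ × ℝ) : ℂ :=
  ((p.2 * (1 - p.2) : ℝ) : ℂ) ^ (a - 1) * (p.1 : ℂ) ^ (w - 1)

/-- The two-variable Mellin transform of `f` over the strip. -/
noncomputable def mellin₂ (a w : ℂ) (f : ℝ → ℝ → ℝ) : ℂ :=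
  ∫ p in strip, ker a w p * (f p.1 p.2 : ℂ)

theorem mul_one_sub_pos {v : ℝ} (hv : v ∈ Ioo (0:ℝ) 1) : 0 < v * (1 - v) :=
  mul_pos hv.1 (sub_pos.2 hv.2)

theorem norm_ker {a w : ℂ} {p : ℝ × ℝ} (hp : p ∈ strip) :
    ‖ker a w p‖ = (p.2 * (1 - p.2)) ^ (a.re - 1) * p.1 ^ (w.re - 1) := by
  rw [ker, norm_mul, Complex.norm_cpow_eq_rpow_re_of_pos (mul_one_sub_pos hp.2),
    Complex.norm_cpow_eq_rpow_re_of_pos hp.1]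
  simp

theorem continuousOn_ker (a w : ℂ) : ContinuousOn (ker a w) strip := by
  unfold ker
  refine ContinuousOn.mul ?_ ?_
  · refine ContinuousOn.cpow_const (by fun_prop) fun p hp => Or.inl ?_
    rw [Complex.ofReal_re]; exact mul_one_sub_pos hp.2
  · refine ContinuousOn.cpow_const (by fun_prop) fun p hp => Or.inl ?_
    rw [Complex.ofReal_re]; exact hp.1

theorem integrableOn_beta {τ : ℝ} (h : 0 < τ) :
    IntegrableOn (fun v : ℝ => (v * (1 - v)) ^ (τ - 1)) (Ioo 0 1) := by
  have h1 := (Complex.betaIntegral_convergent (u := τ) (v := τ) (by simpa) (by simpa)).norm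
  rw [intervalIntegrable_iff_integrableOn_Ioo_of_le zero_le_one] at h1
  refine h1.congr_fun (fun v hv => ?_) measurableSet_Ioo
  have h2 : (1 - (v:ℂ)) = ((1 - v : ℝ) : ℂ) := by push_cast; rfl
  simp only
  rw [norm_mul, h2, Complex.norm_cpow_eq_rpow_re_of_pos hv.1,
    Complex.norm_cpow_eq_rpow_re_of_pos (sub_pos.2 hv.2),
    Real.mul_rpow hv.1.le (sub_pos.2 hv.2).le]
  simp

theorem ExpBdd.integrableOn {c : ℝ} {f : ℝ → ℝ → ℝ} (hf : ExpBdd c f) (hc : 0 < c) {a w : ℂ}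
    (ha : 0 < a.re) (hw : 0 < w.re) :
    IntegrableOn (fun p => ker a w p * (f p.1 p.2 : ℂ)) strip := by
  obtain ⟨C, hC⟩ := hf.bdd
  have h1 := integrableOn_rpow_mul_exp_neg_mul_rpow (p := 1) (s := w.re - 1) (b := c)
    (by linarith) one_pos hc
  have h2 := integrableOn_beta ha
  have h3 := (Integrable.mul_prod h1 h2).const_mul C
  rw [← volume_restrict_strip] at h3
  have hcont : ContinuousOn (fun p : ℝ × ℝ => (f p.1 p.2 : ℂ)) strip :=
    Complex.continuous_ofReal.comp_continuousOn (hf.cont.mono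
      (prod_mono Ioi_subset_Ici_self Ioo_subset_Icc_self))
  refine h3.mono' (((continuousOn_ker a w).mul hcont).aestronglyMeasurable measurableSet_strip) ?_
  refine (ae_restrict_mem measurableSet_strip).mono fun p hp => ?_
  have h4 := hC p.1 p.2 (le_of_lt hp.1) hp.2.1.le hp.2.2.le
  have h5 : 0 ≤ (p.2 * (1 - p.2)) ^ (a.re - 1) * p.1 ^ (w.re - 1) :=
    mul_nonneg (Real.rpow_nonneg (mul_one_sub_pos hp.2).le _) (Real.rpow_nonneg (le_of_lt hp.1) _)
  rw [norm_mul, norm_ker hp, Complex.norm_real, Real.norm_eq_abs]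
  refine (mul_le_mul_of_nonneg_left h4 h5).trans_eq ?_
  rw [Real.rpow_one]; ring

theorem ExpBdd.continuous_right {c : ℝ} {f : ℝ → ℝ → ℝ} (hf : ExpBdd c f) {r : ℝ} (hr : 0 ≤ r) :
    ContinuousOn (fun v => f r v) (Icc 0 1) :=
  hf.cont.comp (f := fun v => (r, v)) (by fun_prop) fun _ hv => ⟨hr, hv⟩

theorem ExpBdd.continuous_left {c : ℝ} {f : ℝ → ℝ → ℝ} (hf : ExpBdd c f) {v : ℝ}
    (hv : v ∈ Icc (0:ℝ) 1) : ContinuousOn (fun r => f r v) (Ici 0) :=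
  hf.cont.comp (f := fun r => (r, v)) (by fun_prop) fun _ hr => ⟨hr, hv⟩

theorem ExpBdd.tendsto_rpow_mul {c : ℝ} {f : ℝ → ℝ → ℝ} (hf : ExpBdd c f) (hc : 0 < c) {v : ℝ}
    (hv : v ∈ Icc (0:ℝ) 1) (w : ℝ) : Tendsto (fun r => r ^ w * |f r v|) atTop (𝓝 0) := by
  obtain ⟨C, hC⟩ := hf.bdd
  have h1 := (tendsto_rpow_mul_exp_neg_mul_atTop_nhds_zero w c hc).const_mul C
  rw [mul_zero] at h1
  refine tendsto_of_tendsto_of_tendsto_of_le_of_le' tendsto_const_nhds h1 ?_ ?_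
  · filter_upwards [eventually_ge_atTop 0] with r hr
    positivity
  · filter_upwards [eventually_ge_atTop 0] with r hr
    refine (mul_le_mul_of_nonneg_left (hC r v hr hv.1 hv.2) (Real.rpow_nonneg hr w)).trans_eq ?_
    ring

theorem HasPartials.ofReal_left {f fr fv : ℝ → ℝ → ℝ} (hp : HasPartials f fr fv) {r v : ℝ}
    (hr : 0 ≤ r) (h0 : 0 ≤ v) (h1 : v ≤ 1) :
    HasDerivAt (fun t => (f t v : ℂ)) (fr r v : ℂ) r :=
  (hp.left r v hr h0 h1).ofReal_comp

theorem integral_left_eq_zero {c : ℝ} {f fr fv : ℝ → ℝ → ℝ} (hf : ExpBdd c f)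
    (hp : HasPartials f fr fv) (hc : 0 < c) {w : ℂ} (hw : 0 < w.re) {v : ℝ}
    (hv : v ∈ Icc (0:ℝ) 1)
    (hi : IntegrableOn (fun r : ℝ => w * (r:ℂ) ^ (w - 1) * f r v + (r:ℂ) ^ w * fr r v) (Ioi 0)) :
    ∫ r in Ioi (0:ℝ), (w * (r:ℂ) ^ (w - 1) * f r v + (r:ℂ) ^ w * fr r v) = 0 := by
  have hw0 : w ≠ 0 := by rintro rfl; simp at hw
  have h := integral_Ioi_of_hasDerivAt_of_tendsto (a := 0)
    (f := fun r : ℝ => (r:ℂ) ^ w * (f r v : ℂ)) (m := 0) ?_ ?_ hi ?_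
  · rw [h]; simp [hw0]
  · refine ContinuousWithinAt.mul ?_ ?_
    · exact (Complex.continuous_ofReal_cpow_const hw).continuousWithinAt
    · exact Complex.continuous_ofReal.continuousAt.comp_continuousWithinAt
        (hf.continuous_left hv 0 self_mem_Ici)
  · intro r hr
    exact (hasDerivAt_ofReal_cpow_const (x := r) (ne_of_gt hr) hw0).mul
      (hp.ofReal_left (le_of_lt hr) hv.1 hv.2)
  · rw [tendsto_zero_iff_norm_tendsto_zero]
    refine (hf.tendsto_rpow_mul hc hv w.re).congr' ?_
    filter_upwards [eventually_gt_atTop 0] with r hr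
    rw [norm_mul, Complex.norm_cpow_eq_rpow_re_of_pos hr, Complex.norm_real, Real.norm_eq_abs]

theorem mul_mellin₂_left {c : ℝ} {f fr fv : ℝ → ℝ → ℝ} (hf : ExpBdd c f) (hfr : ExpBdd c fr)
    (hp : HasPartials f fr fv) (hc : 0 < c) {a w : ℂ} (ha : 0 < a.re) (hw : 0 < w.re) :
    w * mellin₂ a w f = -mellin₂ a (w + 1) fr := by
  have i1 := (hf.integrableOn hc ha hw).const_mul w
  have i2 := hfr.integrableOn hc ha (w := w + 1) (by simp; linarith)
  rw [← add_eq_zero_iff_eq_neg, mellin₂, mellin₂, ← integral_const_mul, ← integral_add i1 i2]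
  have i3 := i1.fun_add i2
  rw [volume_restrict_strip] at i3 ⊢
  have hsec := i3.prod_left_ae
  rw [integral_prod_symm _ i3]
  refine integral_eq_zero_of_ae ?_
  filter_upwards [hsec, ae_restrict_mem measurableSet_Ioo] with v hv hv1
  have hx : ((v * (1 - v) : ℝ) : ℂ) ^ (a - 1) ≠ 0 := by
    rw [Complex.cpow_ne_zero_iff]
    left
    exact_mod_cast (mul_one_sub_pos hv1).ne'
  have key : ∀ r : ℝ, w * (ker a w (r, v) * (f r v : ℂ)) + ker a (w + 1) (r, v) * (fr r v : ℂ)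
      = ((v * (1 - v) : ℝ) : ℂ) ^ (a - 1) *
        (w * (r:ℂ) ^ (w - 1) * f r v + (r:ℂ) ^ w * fr r v) := by
    intro r
    simp only [ker, add_sub_cancel_right]; ring
  simp only [key, Pi.zero_apply] at hv ⊢
  rw [integral_const_mul, integral_left_eq_zero hf hp hc hw ⟨hv1.1.le, hv1.2.le⟩, mul_zero]
  exact (integrable_const_mul_iff (IsUnit.mk0 _ hx) _).1 hv

theorem integral_right_eq_zero {c : ℝ} {f fr fv : ℝ → ℝ → ℝ} (hf : ExpBdd c f)
    (hp : HasPartials f fr fv) {a : ℂ} (ha : 0 < a.re) {r : ℝ} (hr : 0 ≤ r)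
    (hi : IntegrableOn (fun v : ℝ => a * ((v * (1 - v) : ℝ) : ℂ) ^ (a - 1) * f r v -
      ((4 * a + 2) * ((v * (1 - v) : ℝ) : ℂ) ^ a * f r v -
        ((v * (1 - v) : ℝ) : ℂ) ^ a * ((fv r v * (1 - 2 * v) : ℝ) : ℂ))) (Ioo 0 1)) :
    ∫ v in Ioo (0:ℝ) 1, (a * ((v * (1 - v) : ℝ) : ℂ) ^ (a - 1) * f r v -
      ((4 * a + 2) * ((v * (1 - v) : ℝ) : ℂ) ^ a * f r v -
        ((v * (1 - v) : ℝ) : ℂ) ^ a * ((fv r v * (1 - 2 * v) : ℝ) : ℂ))) = 0 := by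
  have ha0 : a ≠ 0 := by rintro rfl; simp at ha
  rw [← integral_Ioc_eq_integral_Ioo, ← intervalIntegral.integral_of_le zero_le_one]
  have h := intervalIntegral.integral_eq_sub_of_hasDerivAt_of_le (zero_le_one (α := ℝ))
    (f := fun v : ℝ => ((v * (1 - v) : ℝ) : ℂ) ^ a * ((1 - 2 * v : ℝ) : ℂ) * (f r v : ℂ)) ?_ ?_
    ((intervalIntegrable_iff_integrableOn_Ioo_of_le zero_le_one).2 hi)
  · rw [h]; simp [ha0]
  · refine ContinuousOn.mul (ContinuousOn.mul ?_ ?_) ?_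
    · exact ((Complex.continuous_ofReal_cpow_const ha).comp
        (by fun_prop : Continuous fun v : ℝ => v * (1 - v))).continuousOn
    · fun_prop
    · exact Complex.continuous_ofReal.comp_continuousOn (hf.continuous_right hr)
  · intro v hv
    have hpos := mul_one_sub_pos hv
    have h1 := hasDerivAt_ofReal_cpow_const (x := v * (1 - v)) hpos.ne' ha0
    have h2 : HasDerivAt (fun v : ℝ => v * (1 - v)) (1 - 2 * v) v :=
      ((hasDerivAt_id' v).mul ((hasDerivAt_id' v).const_sub 1)).congr_deriv (by ring)
    have h3 := h1.scomp v h2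
    have h4 : HasDerivAt (fun v : ℝ => ((1 - 2 * v : ℝ) : ℂ)) ((-2 : ℝ) : ℂ) v :=
      HasDerivAt.ofReal_comp (f := fun v : ℝ => 1 - 2 * v)
        ((((hasDerivAt_id' v).const_mul 2).const_sub 1).congr_deriv (by ring))
    have h5 := (hp.right r v hr hv.1.le hv.2.le).ofReal_comp
    have h6 := (h3.mul h4).mul h5
    refine h6.congr_deriv ?_
    · have hx : ((v * (1 - v) : ℝ) : ℂ) ≠ 0 := by exact_mod_cast hpos.ne'
      have hpow : ((v * (1 - v) : ℝ) : ℂ) ^ a =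
          ((v * (1 - v) : ℝ) : ℂ) ^ (a - 1) * ((v * (1 - v) : ℝ) : ℂ) := by
        rw [Complex.cpow_sub _ _ hx, Complex.cpow_one, div_mul_cancel₀ _ hx]
      simp only [Pi.mul_apply, Function.comp_apply, Complex.real_smul]
      rw [hpow]
      push_cast
      ring

theorem mul_mellin₂_right {c : ℝ} {f fr fv : ℝ → ℝ → ℝ} (hf : ExpBdd c f)
    (hg : ExpBdd c (fun r v => fv r v * (1 - 2 * v)))
    (hp : HasPartials f fr fv) (hc : 0 < c) {a w : ℂ} (ha : 0 < a.re) (hw : 0 < w.re) :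
    a * mellin₂ a w f = (4 * a + 2) * mellin₂ (a + 1) w f -
      mellin₂ (a + 1) w (fun r v => fv r v * (1 - 2 * v)) := by
  have ha1 : 0 < (a + 1).re := by simp; linarith
  have i1 := (hf.integrableOn hc ha hw).const_mul a
  have i2 := (hf.integrableOn hc ha1 hw).const_mul (4 * a + 2)
  have i3 := hg.integrableOn hc ha1 hw
  have i23 : Integrable (fun p => (4 * a + 2) * (ker (a + 1) w p * (f p.1 p.2 : ℂ)) -
      ker (a + 1) w p * ((fv p.1 p.2 * (1 - 2 * p.2) : ℝ) : ℂ)) (volume.restrict strip) :=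
    i2.sub i3
  have i4 : Integrable (fun p => a * (ker a w p * (f p.1 p.2 : ℂ)) -
      ((4 * a + 2) * (ker (a + 1) w p * (f p.1 p.2 : ℂ)) -
      ker (a + 1) w p * ((fv p.1 p.2 * (1 - 2 * p.2) : ℝ) : ℂ))) (volume.restrict strip) :=
    i1.sub i23
  rw [← sub_eq_zero, mellin₂, mellin₂, mellin₂, ← integral_const_mul, ← integral_const_mul,
    ← integral_sub i2 i3, ← integral_sub i1 i23]
  rw [volume_restrict_strip] at i4 ⊢
  have hsec := i4.prod_right_ae
  rw [integral_prod _ i4]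
  refine integral_eq_zero_of_ae ?_
  filter_upwards [hsec, ae_restrict_mem measurableSet_Ioi] with r hr hr1
  have hx : (r : ℂ) ^ (w - 1) ≠ 0 := by
    rw [Complex.cpow_ne_zero_iff]
    left
    exact_mod_cast (ne_of_gt hr1)
  have key : ∀ v : ℝ, a * (ker a w (r, v) * (f r v : ℂ)) -
      ((4 * a + 2) * (ker (a + 1) w (r, v) * (f r v : ℂ)) -
        ker (a + 1) w (r, v) * ((fv r v * (1 - 2 * v) : ℝ) : ℂ))
      = (r : ℂ) ^ (w - 1) * (a * ((v * (1 - v) : ℝ) : ℂ) ^ (a - 1) * f r v -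
      ((4 * a + 2) * ((v * (1 - v) : ℝ) : ℂ) ^ a * f r v -
        ((v * (1 - v) : ℝ) : ℂ) ^ a * ((fv r v * (1 - 2 * v) : ℝ) : ℂ))) := by
    intro v
    simp only [ker, add_sub_cancel_right]; ring
  simp only [key, Pi.zero_apply] at hr ⊢
  rw [integral_const_mul, integral_right_eq_zero hf hp ha (le_of_lt hr1), mul_zero]
  exact (integrable_const_mul_iff (IsUnit.mk0 _ hx) _).1 hr

theorem abs_log_mul_rpow_le {x η τ : ℝ} (hx : 0 < x) (hη : 0 < η) (hτ : |τ| ≤ η) :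
    |Real.log x| * x ^ τ ≤ 2 / η * (x ^ (2 * η) + x ^ (-(2 * η))) := by
  have h1 : Real.log x ≤ x ^ η / η := Real.log_le_rpow_div hx.le hη
  have h2 : -Real.log x ≤ x ^ (-η) / η := by
    have := Real.log_le_rpow_div (inv_pos.2 hx).le hη
    rwa [Real.log_inv, Real.inv_rpow hx.le, ← Real.rpow_neg hx.le] at this
  have p1 := Real.rpow_pos_of_pos hx η
  have p2 := Real.rpow_pos_of_pos hx (-η)
  have h3 : |Real.log x| ≤ (x ^ η + x ^ (-η)) / η := by
    rw [add_div, abs_le']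
    constructor
    · have : 0 < x ^ (-η) / η := by positivity
      linarith
    · have : 0 < x ^ η / η := by positivity
      linarith
  have h4 : x ^ τ ≤ x ^ η + x ^ (-η) := by
    rw [abs_le] at hτ
    rcases le_total 1 x with h | h
    · have := Real.rpow_le_rpow_of_exponent_le h hτ.2
      linarith
    · have := Real.rpow_le_rpow_of_exponent_ge hx h hτ.1
      linarith
  have e1 : x ^ (2 * η) = x ^ η * x ^ η := by rw [← Real.rpow_add hx]; ring_nf
  have e2 : x ^ (-(2 * η)) = x ^ (-η) * x ^ (-η) := by rw [← Real.rpow_add hx]; ring_nf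
  have h5 := mul_le_mul h3 h4 (Real.rpow_pos_of_pos hx τ).le (by positivity)
  refine h5.trans ?_
  rw [e1, e2, div_mul_eq_mul_div, div_mul_eq_mul_div]
  refine div_le_div_of_nonneg_right ?_ hη.le
  nlinarith [sq_nonneg (x ^ η - x ^ (-η))]

theorem ker_shift (a w t : ℂ) {p : ℝ × ℝ} (hp : p ∈ strip) :
    ‖ker (a + t) (w + 2 * t) p‖ = (p.2 * (1 - p.2) * p.1 ^ 2) ^ t.re * ‖ker a w p‖ := by
  have h1 := mul_one_sub_pos hp.2
  have h2 : 0 < p.1 := hp.1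
  rw [norm_ker hp, norm_ker hp, Real.mul_rpow h1.le (by positivity), ← Real.rpow_natCast p.1 2,
    ← Real.rpow_mul h2.le]
  have e1 : (a + t).re - 1 = (a.re - 1) + t.re := by simp; ring
  have e2 : (w + 2 * t).re - 1 = (w.re - 1) + (2:ℕ) * t.re := by simp; ring
  rw [e1, e2, Real.rpow_add h1, Real.rpow_add h2]
  ring

theorem ExpBdd.differentiableAt_mellin₂ {c : ℝ} {f : ℝ → ℝ → ℝ} (hf : ExpBdd c f) (hc : 0 < c)
    (n k : ℂ) {s : ℂ} (ha : 0 < (s + n).re) (hw : 0 < (2 * s + k).re) :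
    DifferentiableAt ℂ (fun s => mellin₂ (s + n) (2 * s + k) f) s := by
  obtain ⟨η, hη, hη1, hη2⟩ : ∃ η > 0, 2 * η < (s + n).re ∧ 4 * η < (2 * s + k).re := by
    refine ⟨min ((s + n).re) ((2 * s + k).re) / 8, by positivity, ?_, ?_⟩
    · have := min_le_left ((s + n).re) ((2 * s + k).re); linarith
    · have := min_le_right ((s + n).re) ((2 * s + k).re); linarith
  have hint : ∀ t : ℝ, |t| ≤ 2 * η →
      IntegrableOn (fun p => ker (s + n + t) (2 * s + k + 2 * t) p * (f p.1 p.2 : ℂ)) strip := by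
    intro t ht
    rw [abs_le] at ht
    refine hf.integrableOn hc ?_ ?_
    · rw [Complex.add_re, Complex.ofReal_re]; linarith
    · have : (2 * (t:ℂ)).re = 2 * t := by simp
      rw [Complex.add_re (2 * s + k), this]; linarith
  have hi1 := hint (2 * η) (by rw [abs_of_pos]; positivity)
  have hi2 := hint (-(2 * η)) (by rw [abs_neg, abs_of_pos]; positivity)
  have hmeas : ∀ s : ℂ, AEStronglyMeasurable
      (fun p => ker (s + n) (2 * s + k) p * (f p.1 p.2 : ℂ)) (volume.restrict strip) := by
    intro s
    have hcont : ContinuousOn (fun p : ℝ × ℝ => (f p.1 p.2 : ℂ)) strip :=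
      Complex.continuous_ofReal.comp_continuousOn (hf.cont.mono
        (prod_mono Ioi_subset_Ici_self Ioo_subset_Icc_self))
    exact ((continuousOn_ker _ _).mul hcont).aestronglyMeasurable measurableSet_strip
  refine (hasDerivAt_integral_of_dominated_loc_of_deriv_le (𝕜 := ℂ)
    (F := fun s p => ker (s + n) (2 * s + k) p * (f p.1 p.2 : ℂ))
    (F' := fun s p => ((Real.log (p.2 * (1 - p.2) * p.1 ^ 2) : ℝ) : ℂ) *
      (ker (s + n) (2 * s + k) p * (f p.1 p.2 : ℂ)))
    (bound := fun p => 2 / η * (‖ker (s + n + (2 * η : ℝ)) (2 * s + k + 2 * (2 * η : ℝ)) p *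
      (f p.1 p.2 : ℂ)‖ + ‖ker (s + n + (-(2 * η) : ℝ)) (2 * s + k + 2 * (-(2 * η) : ℝ)) p *
      (f p.1 p.2 : ℂ)‖)) (Metric.ball_mem_nhds s hη) ?_ ?_ ?_ ?_ ?_ ?_).2.differentiableAt
  · exact Eventually.of_forall hmeas
  · have h0 := hint 0 (by simp; positivity)
    simp only [Complex.ofReal_zero, mul_zero, add_zero] at h0
    exact h0
  · exact (by fun_prop : Measurable fun p : ℝ × ℝ =>
      ((Real.log (p.2 * (1 - p.2) * p.1 ^ 2) : ℝ) : ℂ)).aestronglyMeasurable.mul (hmeas s)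
  · refine (ae_restrict_mem measurableSet_strip).mono fun p hp u hu => ?_
    have hρ : 0 < p.2 * (1 - p.2) * p.1 ^ 2 :=
      mul_pos (mul_one_sub_pos hp.2) (pow_pos hp.1 2)
    have e : ker (u + n) (2 * u + k) p = ker (s + n + (u - s)) (2 * s + k + 2 * (u - s)) p := by
      congr 1 <;> ring
    have hτ : |(u - s).re| ≤ η :=
      (Complex.abs_re_le_norm _).trans (by rw [← dist_eq_norm]; exact (Metric.mem_ball.1 hu).le)
    rw [e, norm_mul, norm_mul, norm_mul, norm_mul, ker_shift _ _ _ hp, ker_shift _ _ _ hp,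
      ker_shift _ _ _ hp, Complex.norm_real, Real.norm_eq_abs, Complex.ofReal_re,
      Complex.ofReal_re]
    have h := abs_log_mul_rpow_le hρ hη hτ
    have h0 : 0 ≤ ‖ker (s + n) (2 * s + k) p‖ * ‖(f p.1 p.2 : ℂ)‖ := by positivity
    calc _ = (|Real.log (p.2 * (1 - p.2) * p.1 ^ 2)| *
          (p.2 * (1 - p.2) * p.1 ^ 2) ^ (u - s).re) *
          (‖ker (s + n) (2 * s + k) p‖ * ‖(f p.1 p.2 : ℂ)‖) := by ring
      _ ≤ _ := mul_le_mul_of_nonneg_right h h0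
      _ = _ := by ring
  · exact (hi1.norm.add hi2.norm).const_mul _
  · refine (ae_restrict_mem measurableSet_strip).mono fun p hp u hu => ?_
    have h1 := mul_one_sub_pos hp.2
    have h2 : 0 < p.1 := hp.1
    have d1 : HasDerivAt (fun u : ℂ => u + n - 1) 1 u := by
      simpa using ((hasDerivAt_id' u).add_const n).sub_const 1
    have d2 : HasDerivAt (fun u : ℂ => 2 * u + k - 1) 2 u := by
      simpa using (((hasDerivAt_id' u).const_mul 2).add_const k).sub_const 1
    have n1 : ((p.2 * (1 - p.2) : ℝ) : ℂ) ≠ 0 := by exact_mod_cast h1.ne'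
    have n2 : (p.1 : ℂ) ≠ 0 := by exact_mod_cast h2.ne'
    have d3 := ((d1.const_cpow (Or.inl n1)).mul (d2.const_cpow (Or.inl n2))).mul_const
      (f p.1 p.2 : ℂ)
    refine d3.congr_deriv ?_
    rw [Real.log_mul h1.ne' (by positivity), Real.log_pow]
    simp only [ker, ← Complex.ofReal_log h1.le, ← Complex.ofReal_log h2.le]
    push_cast
    ring

/-- The two-variable Mellin transform divided by the Gamma factors. -/
noncomputable def mellinΓ (a w : ℂ) (f : ℝ → ℝ → ℝ) : ℂ :=
  mellin₂ a w f * ((Complex.Gamma a)⁻¹ * (Complex.Gamma w)⁻¹)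

theorem mellinΓ_left {c : ℝ} {f fr fv : ℝ → ℝ → ℝ} (hf : ExpBdd c f) (hfr : ExpBdd c fr)
    (hp : HasPartials f fr fv) (hc : 0 < c) {a w : ℂ} (ha : 0 < a.re) (hw : 0 < w.re) :
    mellinΓ a w f = -mellinΓ a (w + 1) fr := by
  have hw0 : w ≠ 0 := by rintro rfl; simp at hw
  have h := mul_mellin₂_left hf hfr hp hc ha hw
  rw [mellinΓ, mellinΓ, Complex.Gamma_add_one w hw0, mul_inv, ← neg_mul, ← h]
  field_simp

theorem mellinΓ_right {c : ℝ} {f fr fv : ℝ → ℝ → ℝ} (hf : ExpBdd c f)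
    (hg : ExpBdd c (fun r v => fv r v * (1 - 2 * v)))
    (hp : HasPartials f fr fv) (hc : 0 < c) {a w : ℂ} (ha : 0 < a.re) (hw : 0 < w.re) :
    mellinΓ a w f = (4 * a + 2) * mellinΓ (a + 1) w f -
      mellinΓ (a + 1) w (fun r v => fv r v * (1 - 2 * v)) := by
  have ha0 : a ≠ 0 := by rintro rfl; simp at ha
  have h := mul_mellin₂_right hf hg hp hc ha hw
  have e : mellinΓ a w f = (a * mellin₂ a w f) *
      ((Complex.Gamma (a + 1))⁻¹ * (Complex.Gamma w)⁻¹) := by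
    rw [mellinΓ, Complex.Gamma_add_one a ha0, mul_inv]
    field_simp
  rw [e, h, mellinΓ, mellinΓ]
  ring

theorem ExpBdd.differentiableAt_mellinΓ {c : ℝ} {f : ℝ → ℝ → ℝ} (hf : ExpBdd c f) (hc : 0 < c)
    (n k : ℂ) {s : ℂ} (ha : 0 < (s + n).re) (hw : 0 < (2 * s + k).re) :
    DifferentiableAt ℂ (fun s => mellinΓ (s + n) (2 * s + k) f) s := by
  refine (hf.differentiableAt_mellin₂ hc n k ha hw).mul (DifferentiableAt.mul ?_ ?_)
  · exact DifferentiableAt.comp s (f := fun s => s + n) (g := fun z => (Complex.Gamma z)⁻¹)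
      (Complex.differentiable_one_div_Gamma _) (by fun_prop)
  · exact DifferentiableAt.comp s (f := fun s => 2 * s + k) (g := fun z => (Complex.Gamma z)⁻¹)
      (Complex.differentiable_one_div_Gamma _) (by fun_prop)

theorem moderate_one_sub_two_mul : Moderate (fun _ v => 1 - 2 * v) := by
  have h : (fun _ v : ℝ => 1 - 2 * v) = fun _ v : ℝ => 1 + v * (-2) := by
    funext r v; ring
  rw [h]
  exact (moderate_const 1).add (moderate_snd.mul (moderate_const (-2)))

theorem SmoothExp.exists_continuation (M : ℕ) : ∀ (d : ℕ) {c : ℝ} {f : ℝ → ℝ → ℝ} (_ : 0 < c)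
    (_ : SmoothExp d c f) {n k : ℤ} (_ : 0 ≤ n) (_ : -2 ≤ k)
    (_ : (M - n).toNat + (2 * M - k).toNat ≤ d),
    ∃ E : ℂ → ℂ, DifferentiableOn ℂ E {s | -(M:ℝ) < s.re} ∧
      ∀ s : ℂ, 1 < s.re → E s = mellinΓ (s + n) (2 * s + k) f := by
  have re1 : ∀ (s : ℂ) (n : ℤ), (s + n).re = s.re + n := by intro s n; simp
  have re2 : ∀ (s : ℂ) (k : ℤ), (2 * s + k).re = 2 * s.re + k := by intro s k; simp
  intro d
  induction d with
  | zero =>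
    intro c f hc hf n k hn hk hd
    have h1 : (M:ℤ) ≤ n := by omega
    have h2 : 2 * (M:ℤ) ≤ k := by omega
    have h1' : (M:ℝ) ≤ n := by exact_mod_cast h1
    have h2' : 2 * (M:ℝ) ≤ k := by exact_mod_cast h2
    refine ⟨fun s => mellinΓ (s + n) (2 * s + k) f, fun s hs => ?_, fun s _ => rfl⟩
    have hs' : -(M:ℝ) < s.re := hs
    refine (ExpBdd.differentiableAt_mellinΓ hf hc n k ?_ ?_).differentiableWithinAt
    · rw [re1]; linarith
    · rw [re2]; linarith
  | succ d ih =>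
    intro c f hc hf n k hn hk hd
    have hn' : (0:ℝ) ≤ n := by exact_mod_cast hn
    have hk' : (-2:ℝ) ≤ k := by exact_mod_cast hk
    by_cases h : (M - n).toNat + (2 * M - k).toNat ≤ d
    · exact ih hc hf.of_succ hn hk h
    have hf' := hf.of_succ
    obtain ⟨h0, fr, fv, hp, hr, hv⟩ := hf
    rcases lt_or_ge n M with hnM | hnM
    · have hg : SmoothExp d (c / 2) (fun r v => fv r v * (1 - 2 * v)) :=
        hv.mul_moderate moderate_one_sub_two_mul (by linarith)
      obtain ⟨E1, hE1, hE1'⟩ := ih hc hf' (n := n + 1) (k := k) (by omega) hk (by omega)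
      obtain ⟨E2, hE2, hE2'⟩ := ih (half_pos hc) hg (n := n + 1) (k := k) (by omega) hk (by omega)
      refine ⟨fun s => (4 * (s + n) + 2) * E1 s - E2 s, ?_, fun s hs => ?_⟩
      · exact (DifferentiableOn.mul (by fun_prop) hE1).sub hE2
      · have h := mellinΓ_right (a := s + n) (w := 2 * s + k) (h0.mono (by linarith)) hg.expBdd hp
          (half_pos hc) (by rw [re1]; linarith) (by rw [re2]; linarith)
        rw [h]
        simp only
        rw [hE1' s hs, hE2' s hs]
        push_cast
        rw [← add_assoc]
    · obtain ⟨E1, hE1, hE1'⟩ := ih hc hr (n := n) (k := k + 1) hn (by omega) (by omega)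
      refine ⟨fun s => -E1 s, hE1.neg, fun s hs => ?_⟩
      simp only
      rw [hE1' s hs, mellinΓ_left h0 hr.expBdd hp hc (by rw [re1]; linarith)
        (by rw [re2]; linarith)]
      push_cast
      rw [add_assoc]

theorem eqOn_of_eq_of_one_lt_re {U : Set ℂ} (hU : IsOpen U) (hU' : IsPreconnected U)
    (h2 : (2:ℂ) ∈ U) {f g : ℂ → ℂ} (hf : DifferentiableOn ℂ f U) (hg : DifferentiableOn ℂ g U)
    (h : ∀ s : ℂ, 1 < s.re → f s = g s) : EqOn f g U := by
  refine (hf.analyticOnNhd hU).eqOn_of_preconnected_of_eventuallyEq (hg.analyticOnNhd hU) hU' h2 ?_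
  have : {s : ℂ | 1 < s.re} ∈ 𝓝 (2:ℂ) :=
    (isOpen_lt continuous_const Complex.continuous_re).mem_nhds (by simp)
  filter_upwards [this] with s hs using h s hs

theorem isOpen_halfPlane (c : ℝ) : IsOpen {s : ℂ | c < s.re} :=
  isOpen_lt continuous_const Complex.continuous_re

theorem isPreconnected_halfPlane (c : ℝ) : IsPreconnected {s : ℂ | c < s.re} :=
  (convex_halfSpace_re_gt c).isPreconnected

theorem exists_entire {f : ℂ → ℂ} (h : ∀ M : ℕ, ∃ E : ℂ → ℂ,
    DifferentiableOn ℂ E {s | -(M:ℝ) < s.re} ∧ ∀ s : ℂ, 1 < s.re → E s = f s) :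
    ∃ E : ℂ → ℂ, Differentiable ℂ E ∧ ∀ s : ℂ, 1 < s.re → E s = f s := by
  choose E hE hE' using h
  have agree : ∀ M N : ℕ, M ≤ N → ∀ s : ℂ, -(M:ℝ) < s.re → E M s = E N s := by
    intro M N hMN s hs
    have hMN' : (M:ℝ) ≤ N := by exact_mod_cast hMN
    refine eqOn_of_eq_of_one_lt_re (isOpen_halfPlane (-(M:ℝ))) (isPreconnected_halfPlane _)
      (by have := Nat.cast_nonneg (α := ℝ) M; simp; linarith)
      (hE M) ((hE N).mono ?_)
      (fun s hs => (hE' M s hs).trans (hE' N s hs).symm) hs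
    intro t ht
    have ht' : -(M:ℝ) < t.re := ht
    change -(N:ℝ) < t.re
    linarith
  have hM : ∀ s : ℂ, -((⌈-s.re⌉₊ + 1 : ℕ) : ℝ) < s.re := by
    intro s
    have := Nat.le_ceil (-s.re)
    push_cast
    linarith
  have key : ∀ (M : ℕ) (s : ℂ), -(M:ℝ) < s.re → E (⌈-s.re⌉₊ + 1) s = E M s := by
    intro M s hs
    rcases le_total M (⌈-s.re⌉₊ + 1) with h | h
    · exact (agree _ _ h s hs).symm
    · exact agree _ _ h s (hM s)
  refine ⟨fun s => E (⌈-s.re⌉₊ + 1) s, fun s => ?_, fun s hs => hE' _ s hs⟩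
  have hnhds := (isOpen_halfPlane (-((⌈-s.re⌉₊ + 1 : ℕ) : ℝ))).mem_nhds (hM s)
  refine ((hE _).differentiableAt hnhds).congr_of_eventuallyEq ?_
  filter_upwards [hnhds] with t ht using key _ t ht

theorem mellin₂_one_one (f : ℝ → ℝ → ℝ) : mellin₂ 1 1 f = ((∫ p in strip, f p.1 p.2 : ℝ) : ℂ) := by
  simp only [mellin₂, ker, sub_self, Complex.cpow_zero, one_mul]
  exact integral_ofReal

theorem ExpBdd.integrableOn_strip {c : ℝ} {f : ℝ → ℝ → ℝ} (hf : ExpBdd c f) (hc : 0 < c) :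
    IntegrableOn (fun p : ℝ × ℝ => f p.1 p.2) strip := by
  have h : Integrable _ _ := hf.integrableOn hc (a := 1) (w := 1) (by simp) (by simp)
  have h2 := h.re
  simp [ker] at h2
  exact h2

theorem integral_strip {c : ℝ} {f fr fv : ℝ → ℝ → ℝ} (hf : ExpBdd c f) (hfv : ExpBdd c fv)
    (hp : HasPartials f fr fv) (hc : 0 < c) :
    2 * (∫ p in strip, f p.1 p.2) - ∫ p in strip, fv p.1 p.2 * (1 - 2 * p.2) =
      ∫ r in Ioi (0:ℝ), (f r 0 + f r 1) := by
  have hg : ExpBdd (c / 2) (fun r v => fv r v * (1 - 2 * v)) :=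
    SmoothExp.mul_moderate (n := 0) hfv moderate_one_sub_two_mul (by linarith)
  have i1 := (hf.integrableOn_strip hc).const_mul 2
  have i2 := hg.integrableOn_strip (half_pos hc)
  have i3 : Integrable (fun p : ℝ × ℝ => 2 * f p.1 p.2 - fv p.1 p.2 * (1 - 2 * p.2))
    (volume.restrict strip) := i1.sub i2
  rw [← integral_const_mul, ← integral_sub i1 i2]
  rw [volume_restrict_strip] at i3 ⊢
  rw [integral_prod _ i3]
  refine setIntegral_congr_fun measurableSet_Ioi fun r hr => ?_
  have hr0 : (0:ℝ) ≤ r := le_of_lt hr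
  simp only
  rw [← integral_Ioc_eq_integral_Ioo, ← intervalIntegral.integral_of_le zero_le_one]
  have h := intervalIntegral.integral_eq_sub_of_hasDerivAt (a := 0) (b := 1)
    (f := fun v => -(f r v * (1 - 2 * v))) (f' := fun v => 2 * f r v - fv r v * (1 - 2 * v)) ?_ ?_
  · rw [h]; ring
  · intro v hv
    rw [uIcc_of_le zero_le_one] at hv
    have h1 := (hp.right r v hr0 hv.1 hv.2).mul (((hasDerivAt_id' v).const_mul 2).const_sub 1)
    exact h1.fun_neg.congr_deriv (by ring)
  · refine ContinuousOn.intervalIntegrable ?_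
    rw [uIcc_of_le zero_le_one]
    exact ((hf.continuous_right hr0).const_mul 2).sub
      ((hfv.continuous_right hr0).mul (by fun_prop))

theorem integral_partial {c : ℝ} {f fr fv : ℝ → ℝ → ℝ} (hf : ExpBdd c f) (hfr : ExpBdd c fr)
    (hp : HasPartials f fr fv) (hc : 0 < c) {v : ℝ} (hv : v ∈ Icc (0:ℝ) 1) :
    IntegrableOn (fun r => fr r v) (Ioi 0) ∧ ∫ r in Ioi (0:ℝ), fr r v = -f 0 v := by
  have hi : IntegrableOn (fun r => fr r v) (Ioi 0) := by
    obtain ⟨C, hC⟩ := hfr.bdd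
    have h1 := integrableOn_rpow_mul_exp_neg_mul_rpow (p := 1) (s := 0) (b := c)
      (by linarith) one_pos hc
    refine Integrable.mono' (h1.const_mul C) (((hfr.continuous_left hv).mono
      Ioi_subset_Ici_self).aestronglyMeasurable measurableSet_Ioi) ?_
    refine (ae_restrict_mem measurableSet_Ioi).mono fun r hr => ?_
    simpa using hC r v (le_of_lt hr) hv.1 hv.2
  refine ⟨hi, ?_⟩
  rw [integral_Ioi_of_hasDerivAt_of_tendsto (f := fun r => f r v) (m := 0)
    ((hf.continuous_left hv 0 self_mem_Ici)) (fun r hr => hp.left r v (le_of_lt hr) hv.1 hv.2) hi]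
  · simp
  · rw [tendsto_zero_iff_norm_tendsto_zero]
    simpa using hf.tendsto_rpow_mul hc hv 0

theorem HasPartials.second_eq {f f1 f1v f2 f2v : ℝ → ℝ → ℝ} (hp : HasPartials f f1 f1v)
    (hp1 : HasPartials f1 f2 f2v) {v : ℝ} (hv : v ∈ Icc (0:ℝ) 1) {g : ℝ → ℝ} {D : ℝ}
    (hg : ∀ r, 0 ≤ r → HasDerivAt (fun t => f t v) (g r) r) (hD : HasDerivAt g D 0) :
    f2 0 v = D := by
  have e : ∀ r, 0 ≤ r → f1 r v = g r := fun r hr => (hp.left r v hr hv.1 hv.2).unique (hg r hr)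
  have h1 := (hp1.left 0 v le_rfl hv.1 hv.2).hasDerivWithinAt (s := Ici 0)
  have h2 := (hD.hasDerivWithinAt (s := Ici 0)).congr (f₁ := fun t => f1 t v)
    (fun r hr => e r hr) (e 0 le_rfl)
  exact (uniqueDiffOn_Ici (0:ℝ) 0 self_mem_Ici).eq_deriv _ h1 h2

theorem value_at_zero {c : ℝ} (hc : 0 < c) {f : ℝ → ℝ → ℝ} (hf : SmoothExp 4 c f) {E : ℂ → ℂ}
    (hE : Differentiable ℂ E) (hE' : ∀ s : ℂ, 1 < s.re → E s = mellinΓ s (2 * s - 2) f)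
    {g₀ g₁ : ℝ → ℝ} {D₀ D₁ : ℝ}
    (h0 : ∀ r, 0 ≤ r → HasDerivAt (fun t => f t 0) (g₀ r) r) (hD₀ : HasDerivAt g₀ D₀ 0)
    (h1 : ∀ r, 0 ≤ r → HasDerivAt (fun t => f t 1) (g₁ r) r) (hD₁ : HasDerivAt g₁ D₁ 0) :
    E 0 = ((D₀ + D₁ : ℝ) : ℂ) := by
  obtain ⟨b0, f1, f1v, p1, s1, -⟩ := hf
  obtain ⟨b1, f2, f2v, p2, s2, -⟩ := s1
  obtain ⟨b2, f3, f3v, p3, s3, -⟩ := s2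
  obtain ⟨b3, f4, f4v, p4, s4, s4v⟩ := s3
  have b4 : ExpBdd c f4v := s4v
  rw [← p1.second_eq p2 (by simp) h0 hD₀, ← p1.second_eq p2 (by simp) h1 hD₁]
  have hg : ExpBdd (c / 2) (fun r v => f4v r v * (1 - 2 * v)) :=
    SmoothExp.mul_moderate (n := 0) b4 moderate_one_sub_two_mul (by linarith)
  have hc2 := half_pos hc
  have b3' := b3.mono (show c / 2 ≤ c by linarith)
  have key : EqOn E (fun s => -((4 * s + 2) * mellinΓ (s + 1) (2 * s + 1) f3 -
      mellinΓ (s + 1) (2 * s + 1) (fun r v => f4v r v * (1 - 2 * v)))) {s | (-1/2:ℝ) < s.re} := by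
    refine eqOn_of_eq_of_one_lt_re (isOpen_halfPlane _) (isPreconnected_halfPlane _)
      (by simp; norm_num) hE.differentiableOn (fun s hs => ?_) (fun s hs => ?_)
    · have hs' : (-1/2:ℝ) < s.re := hs
      have ha : 0 < (s + 1).re := by simp; linarith
      have hw : 0 < (2 * s + 1).re := by simp; linarith
      exact ((DifferentiableAt.mul (by fun_prop) (b3'.differentiableAt_mellinΓ hc2 1 1 ha hw)).sub
        (hg.differentiableAt_mellinΓ hc2 1 1 ha hw)).neg.differentiableWithinAt
    · have ha : 0 < s.re := by linarith
      rw [hE' s hs, mellinΓ_left b0 b1 p1 hc ha (by simp; linarith),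
        mellinΓ_left b1 b2 p2 hc ha (by simp; linarith),
        mellinΓ_left b2 b3 p3 hc ha (by simp; linarith),
        mellinΓ_right b3' hg p4 hc2 ha (by simp; linarith)]
      ring_nf
  have h := key (show (0:ℂ) ∈ {s : ℂ | (-1/2:ℝ) < s.re} by simp; norm_num)
  simp only [mul_zero, zero_add, mellinΓ, Complex.Gamma_one, inv_one, mul_one,
    mellin₂_one_one] at h
  rw [h]
  have hi := integral_strip b3 b4 p4 hc
  obtain ⟨i0, e0⟩ := integral_partial b2 b3 p3 hc (v := 0) (by simp)
  obtain ⟨i1, e1⟩ := integral_partial b2 b3 p3 hc (v := 1) (by simp)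
  rw [integral_add i0 i1, e0, e1] at hi
  have hi' := congrArg (fun t : ℝ => (t : ℂ)) hi
  push_cast at hi' ⊢
  rw [hi']
  ring

theorem setIntegral_mul_one_sub_cpow (s : ℂ) :
    ∫ v in Ioo (0:ℝ) 1, ((v * (1 - v) : ℝ) : ℂ) ^ (s - 1) = Complex.betaIntegral s s := by
  rw [Complex.betaIntegral, intervalIntegral.integral_of_le zero_le_one,
    integral_Ioc_eq_integral_Ioo]
  refine setIntegral_congr_fun measurableSet_Ioo fun v hv => ?_
  rw [Complex.ofReal_mul, Complex.mul_cpow_ofReal_nonneg hv.1.le (sub_pos.2 hv.2).le]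
  push_cast
  rfl

/-- Feynman's parameter integral. -/
theorem feynman {α β : ℝ} (hα : 0 < α) (hβ : 0 < β) (s : ℂ) :
    ∫ v in Ioo (0:ℝ) 1, ((v * (1 - v) : ℝ) : ℂ) ^ (s - 1) * ((lin α β v : ℝ) : ℂ) ^ (-(2 * s)) =
      ((α * β : ℝ) : ℂ) ^ (-s) * Complex.betaIntegral s s := by
  have hpos : ∀ v ∈ Ioo (0:ℝ) 1, 0 < lin α β v := fun v hv => lin_pos hα hβ hv.1.le hv.2.le
  set g : ℝ → ℝ := fun v => v * α / lin α β v with hg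
  have hsub : ∀ v ∈ Ioo (0:ℝ) 1, 1 - g v = (1 - v) * β / lin α β v := by
    intro v hv
    have := (hpos v hv).ne'
    rw [hg]; field_simp; rw [lin]; ring
  have himage : g '' Ioo 0 1 = Ioo 0 1 := by
    ext u
    constructor
    · rintro ⟨v, hv, rfl⟩
      have h1 := hsub v hv
      have h2 := hpos v hv
      refine ⟨div_pos (mul_pos hv.1 hα) h2, ?_⟩
      have : 0 < 1 - g v := by rw [h1]; exact div_pos (mul_pos (sub_pos.2 hv.2) hβ) h2
      linarith
    · intro hu
      have h1 : 0 < u * β + (1 - u) * α :=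
        add_pos (mul_pos hu.1 hβ) (mul_pos (sub_pos.2 hu.2) hα)
      refine ⟨u * β / (u * β + (1 - u) * α), ⟨div_pos (mul_pos hu.1 hβ) h1, ?_⟩, ?_⟩
      · rw [div_lt_one h1]; linarith [mul_pos (sub_pos.2 hu.2) hα]
      · have e : lin α β (u * β / (u * β + (1 - u) * α)) = α * β / (u * β + (1 - u) * α) := by
          rw [lin]; field_simp; ring
        rw [hg]; simp only; rw [e]; field_simp
  have hderiv : ∀ v ∈ Ioo (0:ℝ) 1,
      HasDerivWithinAt g (α * β / lin α β v ^ 2) (Ioo 0 1) v := by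
    intro v hv
    have h := ((hasDerivAt_id' v).mul_const α).div (hasDerivAt_lin α β v) (hpos v hv).ne'
    refine (h.congr_deriv ?_).hasDerivWithinAt
    rw [lin]; ring
  have hinj : InjOn g (Ioo 0 1) := by
    intro v hv w hw h
    have h1 := (hpos v hv).ne'
    have h2 := (hpos w hw).ne'
    rw [hg] at h
    simp only at h
    rw [div_eq_div_iff h1 h2, lin, lin] at h
    have : α * β * (v - w) = 0 := by linarith
    rcases mul_eq_zero.1 this with h | h
    · exact absurd h (mul_pos hα hβ).ne'
    · linarith
  have key := integral_image_eq_integral_abs_deriv_smul measurableSet_Ioo hderiv hinj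
    (fun u => ((u * (1 - u) : ℝ) : ℂ) ^ (s - 1))
  have hαβ : ((α * β : ℝ) : ℂ) ≠ 0 := by exact_mod_cast (mul_pos hα hβ).ne'
  rw [himage, setIntegral_mul_one_sub_cpow] at key
  rw [key, ← integral_const_mul]
  refine setIntegral_congr_fun measurableSet_Ioo fun v hv => ?_
  have h2 := hpos v hv
  have h3 := mul_one_sub_pos hv
  have hL : ((lin α β v : ℝ) : ℂ) ≠ 0 := by exact_mod_cast h2.ne'
  have e : g v * (1 - g v) = (v * (1 - v)) * ((α * β) * (lin α β v ^ 2)⁻¹) := by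
    rw [hsub v hv, hg]; field_simp
  rw [e, abs_of_pos (div_pos (mul_pos hα hβ) (pow_pos h2 2)), Complex.ofReal_mul (v * (1 - v)),
    Complex.mul_cpow_ofReal_nonneg h3.le (by positivity), Complex.ofReal_mul (α * β),
    Complex.mul_cpow_ofReal_nonneg (by positivity) (by positivity), Complex.real_smul,
    Complex.cpow_sub _ _ hαβ, Complex.cpow_one, Complex.cpow_neg ((α * β : ℝ) : ℂ)]
  have hc : ((α * β : ℝ) : ℂ) ^ s ≠ 0 := by
    rw [Complex.cpow_def_of_ne_zero hαβ]; exact Complex.exp_ne_zero _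
  have e2 : (((lin α β v ^ 2)⁻¹ : ℝ) : ℂ) ^ (s - 1) =
      ((lin α β v : ℝ) : ℂ) ^ (-(2 * s)) * ((lin α β v : ℝ) : ℂ) ^ 2 := by
    have e3 : (((lin α β v ^ 2)⁻¹ : ℝ) : ℂ) = ((lin α β v : ℝ) : ℂ) ^ (-2 : ℂ) := by
      rw [Complex.cpow_neg]; norm_cast
    have e4 : ((lin α β v : ℝ) : ℂ) ^ 2 = ((lin α β v : ℝ) : ℂ) ^ (2 : ℂ) := by norm_cast
    rw [e3, e4, ← Complex.cpow_add _ _ hL, ← Complex.cpow_mul]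
    · congr 1; ring
    all_goals
      rw [← Complex.ofReal_log h2.le]
      have : (((Real.log (lin α β v) : ℝ) : ℂ) * (-2)).im = 0 := by simp
      rw [this]
      linarith [Real.pi_pos]
  rw [e2]
  push_cast
  push_cast at hαβ hc
  field_simp
  rw [mul_assoc _ (α : ℂ), mul_div_cancel_right₀ _ hαβ]

theorem mellin₂_exp {α β : ℝ} (hα : 0 < α) (hβ : 0 < β) {s : ℂ} (hs : 0 < s.re) :
    mellin₂ s (2 * s) (fun r v => Real.exp (-(r * lin α β v))) =
      Complex.Gamma s ^ 2 * ((α * β : ℝ) : ℂ) ^ (-s) := by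
  have hm : 0 < min α β := lt_min hα hβ
  have h0 := (smoothExp_exp (a := α) (a' := β) (x := 1) zero_le_one 0
    (c := min α β / 2) (by linarith)).expBdd
  have hi := h0.integrableOn (half_pos hm) (a := s) (w := 2 * s) hs (by simpa)
  simp only [neg_one_mul] at hi
  have hi' : Integrable _ (volume.restrict strip) := hi
  rw [mellin₂]
  rw [volume_restrict_strip] at hi' ⊢
  rw [integral_prod_symm _ hi']
  have hB := Complex.Gamma_mul_Gamma_eq_betaIntegral hs hs
  rw [sq, hB, ← two_mul, mul_assoc, mul_comm (Complex.betaIntegral s s), ← feynman hα hβ s,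
    ← integral_const_mul]
  refine setIntegral_congr_fun measurableSet_Ioo fun v hv => ?_
  have hp := lin_pos hα hβ hv.1.le hv.2.le
  have hG := Complex.integral_cpow_mul_exp_neg_mul_Ioi (a := 2 * s) (r := (lin α β v : ℝ))
    (by simpa) (by simpa)
  simp only [ker]
  have e : ∀ r : ℝ, ((v * (1 - v) : ℝ) : ℂ) ^ (s - 1) * (r : ℂ) ^ (2 * s - 1) *
      ((Real.exp (-(r * lin α β v)) : ℝ) : ℂ) = ((v * (1 - v) : ℝ) : ℂ) ^ (s - 1) *
      ((r : ℂ) ^ (2 * s - 1) * Complex.exp (-((lin α β v : ℝ) * r))) := by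
    intro r; push_cast; ring_nf
  simp only [e]
  rw [integral_const_mul, hG, one_div, Complex.inv_cpow, Complex.cpow_neg]
  · ring
  · rw [Complex.arg_ofReal_of_nonneg hp.le]; exact Real.pi_pos.ne

theorem hasSum_geometric_exp {A B : ℝ} (hA : 0 < A) (hB : 0 < B) (x y : ℝ) {r : ℝ} (hr : 0 < r) :
    HasSum (fun j : ℕ × ℕ => r ^ 2 * Real.exp (-(r * ((x + j.1) * A + (y + j.2) * B))))
      (Real.exp (-x * (r * A)) * (Real.exp (-y * (r * B)) *
        ((phi 0 (r * A))⁻¹ * (phi 0 (r * B))⁻¹ * (A⁻¹ * B⁻¹)))) := by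
  have geo : ∀ {t : ℝ}, 0 < t → HasSum (fun n : ℕ => Real.exp (-t) ^ n) (1 - Real.exp (-t))⁻¹ :=
    fun {t} ht => hasSum_geometric_of_lt_one (Real.exp_pos _).le
      (by rw [Real.exp_lt_one_iff]; linarith)
  have hrA := mul_pos hr hA
  have hrB := mul_pos hr hB
  have gA := geo hrA
  have gB := geo hrB
  have h := gA.mul gB (gA.summable.mul_of_nonneg gB.summable
    (fun n => by positivity) (fun n => by positivity))
  have h2 := h.mul_left (r ^ 2 * (Real.exp (-x * (r * A)) * Real.exp (-y * (r * B))))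
  have e : ∀ j : ℕ × ℕ, r ^ 2 * Real.exp (-(r * ((x + j.1) * A + (y + j.2) * B))) =
      r ^ 2 * (Real.exp (-x * (r * A)) * Real.exp (-y * (r * B))) *
        (Real.exp (-(r * A)) ^ j.1 * Real.exp (-(r * B)) ^ j.2) := by
    intro j
    have e1 : -(r * ((x + j.1) * A + (y + j.2) * B)) =
        -x * (r * A) + -y * (r * B) + (j.1 * -(r * A) + j.2 * -(r * B)) := by ring
    rw [e1, Real.exp_add, Real.exp_add, Real.exp_add, Real.exp_nat_mul, Real.exp_nat_mul]
    ring
  have e' : Real.exp (-x * (r * A)) * (Real.exp (-y * (r * B)) *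
      ((phi 0 (r * A))⁻¹ * (phi 0 (r * B))⁻¹ * (A⁻¹ * B⁻¹))) =
      r ^ 2 * (Real.exp (-x * (r * A)) * Real.exp (-y * (r * B))) *
        ((1 - Real.exp (-(r * A)))⁻¹ * (1 - Real.exp (-(r * B)))⁻¹) := by
    rw [phi_zero_of_ne hrA.ne', phi_zero_of_ne hrB.ne']
    field_simp
  simp only [e, e']
  exact h2

theorem mellin₂_gen {a a' d d' x y : ℝ} (ha : 0 < a) (ha' : 0 < a') (hd : 0 < d)
    (hd' : 0 < d') (hx : 0 < x) (hy : 0 ≤ y) {s : ℂ} (hs : 1 < s.re) :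
    HasSum (fun j : ℕ × ℕ => Complex.Gamma s ^ 2 *
      ((((x + j.1) * a + (y + j.2) * d) * ((x + j.1) * a' + (y + j.2) * d') : ℝ) : ℂ) ^ (-s))
      (mellin₂ s (2 * s - 2) (gen a a' d d' x y)) := by
  have hs0 : 0 < s.re := by linarith
  have hα : ∀ j : ℕ × ℕ, 0 < (x + j.1) * a + (y + j.2) * d := fun j => by positivity
  have hα' : ∀ j : ℕ × ℕ, 0 < (x + j.1) * a' + (y + j.2) * d' := fun j => by positivity
  have hlin : ∀ (j : ℕ × ℕ) (v : ℝ),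
      lin ((x + j.1) * a + (y + j.2) * d) ((x + j.1) * a' + (y + j.2) * d') v =
        (x + j.1) * lin a a' v + (y + j.2) * lin d d' v := by
    intro j v; simp only [lin]; ring
  have hsum : ∀ p ∈ strip, HasSum (fun j : ℕ × ℕ => p.1 ^ 2 * Real.exp (-(p.1 *
      lin ((x + j.1) * a + (y + j.2) * d) ((x + j.1) * a' + (y + j.2) * d') p.2)))
      (gen a a' d d' x y p.1 p.2) := by
    intro p hp
    simp only [hlin]
    exact hasSum_geometric_exp (lin_pos ha ha' hp.2.1.le hp.2.2.le)
      (lin_pos hd hd' hp.2.1.le hp.2.2.le) x y hp.1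
  have hker : ∀ p ∈ strip, ker s (2 * s) p = ker s (2 * s - 2) p * ((p.1 ^ 2 : ℝ) : ℂ) := by
    intro p hp
    have h0 : (p.1 : ℂ) ≠ 0 := by exact_mod_cast (ne_of_gt hp.1 : p.1 ≠ 0)
    have e : (2 * s - 1 : ℂ) = (2 * s - 2 - 1) + (2:ℕ) := by push_cast; ring
    rw [ker, ker, e, Complex.cpow_add _ _ h0, Complex.cpow_natCast]
    push_cast
    ring
  simp only [← mellin₂_exp (hα _) (hα' _) hs0]
  obtain ⟨c, hc, hf⟩ := smoothExp_gen ha ha' hd hd' hx hy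
  have hgi := (hf 0).expBdd.integrableOn hc (a := s) (w := 2 * s - 2) hs0 (by simp; linarith)
  have hterm : ∀ (j : ℕ × ℕ), ∀ p ∈ strip, ker s (2 * s) p * ((Real.exp (-(p.1 *
      lin ((x + j.1) * a + (y + j.2) * d) ((x + j.1) * a' + (y + j.2) * d') p.2)) : ℝ) : ℂ) =
      ker s (2 * s - 2) p * ((p.1 ^ 2 * Real.exp (-(p.1 *
      lin ((x + j.1) * a + (y + j.2) * d) ((x + j.1) * a' + (y + j.2) * d') p.2)) : ℝ) : ℂ) := by
    intro j p hp
    rw [hker p hp, mul_assoc, ← Complex.ofReal_mul]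
  have hnorm : ∀ p ∈ strip, HasSum (fun j : ℕ × ℕ => ‖ker s (2 * s) p * ((Real.exp (-(p.1 *
      lin ((x + j.1) * a + (y + j.2) * d) ((x + j.1) * a' + (y + j.2) * d') p.2)) : ℝ) : ℂ)‖)
      ‖ker s (2 * s - 2) p * (gen a a' d d' x y p.1 p.2 : ℂ)‖ := by
    intro p hp
    simp only [hterm _ p hp, norm_mul, Complex.norm_real, Real.norm_eq_abs]
    have h1 := (hsum p hp).mul_left ‖ker s (2 * s - 2) p‖
    rw [abs_of_nonneg ((hsum p hp).nonneg fun j => by positivity)]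
    simpa only [Real.abs_exp, abs_pow, sq_abs] using h1
  unfold mellin₂
  refine hasSum_integral_of_dominated_convergence (fun j p => ‖ker s (2 * s) p * ((Real.exp (-(p.1 *
      lin ((x + j.1) * a + (y + j.2) * d) ((x + j.1) * a' + (y + j.2) * d') p.2)) : ℝ) : ℂ)‖)
    (fun j => ?_) (fun j => ae_of_all _ fun p => le_rfl) ?_ ?_ ?_
  · refine ContinuousOn.aestronglyMeasurable ?_ measurableSet_strip
    refine (continuousOn_ker _ _).mul (Continuous.continuousOn ?_)
    unfold lin
    fun_prop
  · exact (ae_restrict_mem measurableSet_strip).mono fun p hp => (hnorm p hp).summable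
  · refine Integrable.congr (f := fun p => ‖ker s (2 * s - 2) p *
      (gen a a' d d' x y p.1 p.2 : ℂ)‖) hgi.norm ?_
    exact (ae_restrict_mem measurableSet_strip).mono fun p hp => (hnorm p hp).tsum_eq.symm
  · refine (ae_restrict_mem measurableSet_strip).mono fun p hp => ?_
    simp only [hterm _ p hp]
    exact (Complex.hasSum_ofReal.2 (hsum p hp)).mul_left _

/-- The restriction of `gen` to a line `v = const`. -/
noncomputable def genLine (A B x y r : ℝ) : ℝ :=
  Real.exp (-x * (r * A)) * (Real.exp (-y * (r * B)) *
    ((phi 0 (r * A))⁻¹ * (phi 0 (r * B))⁻¹ * (A⁻¹ * B⁻¹)))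

/-- The derivative of `genLine`. -/
noncomputable def genLineDeriv (A B x y r : ℝ) : ℝ :=
  genLine A B x y r * (-x * A + -y * B + A * (phi 1 (r * A) * (phi 0 (r * A))⁻¹) +
    B * (phi 1 (r * B) * (phi 0 (r * B))⁻¹))

theorem hasDerivAt_phi_mul (m : ℕ) (A r : ℝ) :
    HasDerivAt (fun r => phi m (r * A)) (-phi (m + 1) (r * A) * A) r := by
  have h := (hasDerivAt_phi m (r * A)).comp r ((hasDerivAt_id' r).mul_const A)
  simpa [Function.comp_def] using h

theorem hasDerivAt_inv_phi_mul {A : ℝ} (hA : 0 < A) {r : ℝ} (hr : 0 ≤ r) :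
    HasDerivAt (fun r => (phi 0 (r * A))⁻¹)
      ((phi 0 (r * A))⁻¹ * (A * (phi 1 (r * A) * (phi 0 (r * A))⁻¹))) r := by
  have hp := (phi_zero_pos (mul_nonneg hr hA.le)).ne'
  refine ((hasDerivAt_phi_mul 0 A r).fun_inv hp).congr_deriv ?_
  simp only [zero_add]
  field_simp

theorem hasDerivAt_exp_neg_mul (x A r : ℝ) : HasDerivAt (fun r => Real.exp (-x * (r * A)))
    (Real.exp (-x * (r * A)) * (-x * A)) r := by
  have h := (((hasDerivAt_id' r).mul_const A).const_mul (-x)).exp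
  simpa using h

theorem hasDerivAt_genLine {A B : ℝ} (hA : 0 < A) (hB : 0 < B) (x y : ℝ) {r : ℝ} (hr : 0 ≤ r) :
    HasDerivAt (genLine A B x y) (genLineDeriv A B x y r) r := by
  have h := (hasDerivAt_exp_neg_mul x A r).mul ((hasDerivAt_exp_neg_mul y B r).mul
    (((hasDerivAt_inv_phi_mul hA hr).mul (hasDerivAt_inv_phi_mul hB hr)).mul_const (A⁻¹ * B⁻¹)))
  refine h.congr_deriv ?_
  simp only [genLineDeriv, genLine, Pi.mul_apply]
  ring

theorem hasDerivAt_genLineDeriv {A B : ℝ} (hA : 0 < A) (hB : 0 < B) (x y : ℝ) :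
    HasDerivAt (genLineDeriv A B x y)
      (2 * B1 x * B1 y + B2 x * (A / B) + B2 y * (B / A)) 0 := by
  have hq : ∀ {A : ℝ}, 0 < A → HasDerivAt
      (fun r => A * (phi 1 (r * A) * (phi 0 (r * A))⁻¹)) (-A ^ 2 / 12) 0 := by
    intro A hA
    refine (((hasDerivAt_phi_mul 1 A 0).mul
      (hasDerivAt_inv_phi_mul hA le_rfl)).const_mul A).congr_deriv ?_
    simp only [zero_mul, phi_apply_zero]
    push_cast
    ring
  have h := (hasDerivAt_genLine hA hB x y le_rfl).mul
    (((hq hA).const_add (-x * A + -y * B)).add (hq hB))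
  refine h.congr_deriv ?_
  simp only [genLineDeriv, genLine, Pi.add_apply, zero_mul, phi_apply_zero, mul_zero,
    Real.exp_zero, B1, B2]
  push_cast
  field_simp
  ring

theorem exists_cone_zeta {a a' d d' x y : ℝ} (ha : 0 < a) (ha' : 0 < a') (hd : 0 < d)
    (hd' : 0 < d') (hx : 0 < x) (hy : 0 ≤ y) :
    ∃ E : ℂ → ℂ, Differentiable ℂ E ∧
      E 0 = ((4 * (B1 x * B1 y) + B2 x * (a / d + a' / d') + B2 y * (d / a + d' / a') : ℝ) : ℂ) ∧
      ∀ s : ℂ, 1 < s.re → HasSum (fun j : ℕ × ℕ =>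
        ((((x + j.1) * a + (y + j.2) * d) * ((x + j.1) * a' + (y + j.2) * d') : ℝ) : ℂ) ^ (-s))
        (E s * (Complex.Gamma (2 * s - 2) / Complex.Gamma s)) := by
  obtain ⟨c, hc, hf⟩ := smoothExp_gen ha ha' hd hd' hx hy
  obtain ⟨E, hE, hE'⟩ := exists_entire (f := fun s => mellinΓ s (2 * s - 2) (gen a a' d d' x y))
    fun M => by
      obtain ⟨E, hE, hE'⟩ := SmoothExp.exists_continuation M (M + (2 * M + 2)) hc (hf _)
        (n := 0) (k := -2) le_rfl le_rfl (by omega)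
      refine ⟨E, hE, fun s hs => (hE' s hs).trans ?_⟩
      simp [sub_eq_add_neg]
  refine ⟨E, hE, ?_, fun s hs => ?_⟩
  · have e1 : ∀ t, gen a a' d d' x y t 1 = genLine a d x y t := by simp [gen, genLine, lin]
    have e0 : ∀ t, gen a a' d d' x y t 0 = genLine a' d' x y t := by simp [gen, genLine, lin]
    rw [value_at_zero hc (hf 4) hE hE' (g₀ := genLineDeriv a' d' x y) (g₁ := genLineDeriv a d x y)
      (fun r hr => by simpa only [e0] using hasDerivAt_genLine ha' hd' x y hr)
      (hasDerivAt_genLineDeriv ha' hd' x y)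
      (fun r hr => by simpa only [e1] using hasDerivAt_genLine ha hd x y hr)
      (hasDerivAt_genLineDeriv ha hd x y)]
    congr 1
    ring
  · have hs0 : 0 < s.re := by linarith
    have hG : Complex.Gamma s ≠ 0 := Complex.Gamma_ne_zero_of_re_pos hs0
    have hG' : Complex.Gamma (2 * s - 2) ≠ 0 :=
      Complex.Gamma_ne_zero_of_re_pos (by simp; linarith)
    have h := (mellin₂_gen ha ha' hd hd' hx hy hs).mul_left ((Complex.Gamma s ^ 2)⁻¹)
    simp only [inv_mul_cancel_left₀ (pow_ne_zero 2 hG)] at h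
    have e : E s * (Complex.Gamma (2 * s - 2) / Complex.Gamma s) =
        (Complex.Gamma s ^ 2)⁻¹ * mellin₂ s (2 * s - 2) (gen a a' d d' x y) := by
      rw [hE' s hs, mellinΓ]
      generalize Complex.Gamma (2 * s - 2) = G at hG' ⊢
      field_simp
    rw [e]
    exact h

end

/-- A sequence `A` of totally positive elements satisfying a minus continued fraction
recurrence, on which multiplication by the totally positive unit `ε > 1` acts as a shift. -/
structure IsConeSeq {K : Type*} [Field K] (σ σ' : K →+* ℝ) (A : ℤ → K) (b : ℤ → ℤ) (m : ℕ)
    (ε : K) : Prop where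
  m_pos : 0 < m
  add_one : ∀ i : ℤ, A (i + 1) = (b i : K) * A i - A (i - 1)
  pos : ∀ i, 0 < σ (A i)
  pos' : ∀ i, 0 < σ' (A i)
  det_pos : ∀ i, 0 < σ (A (i - 1)) * σ' (A i) - σ (A i) * σ' (A (i - 1))
  shift : ∀ i : ℤ, ε * A i = A (i - m)
  one_lt : 1 < σ ε
  norm_eq : σ ε * σ' ε = 1

theorem pos_and_lt_succ {u c : ℕ → ℝ} (hc : ∀ n, 2 ≤ c n) (h0 : 0 < u 0) (h1 : u 0 < u 1)
    (hrec : ∀ n, u (n + 2) = c n * u (n + 1) - u n) (n : ℕ) : 0 < u n ∧ u n < u (n + 1) := by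
  induction n with
  | zero => exact ⟨h0, h1⟩
  | succ n ih =>
    have h2 : 0 < u (n + 1) := ih.1.trans ih.2
    refine ⟨h2, ?_⟩
    have := mul_le_mul_of_nonneg_right (hc n) h2.le
    have := hrec n
    have e : n + 1 + 1 = n + 2 := rfl
    rw [e]
    linarith [ih.2]

theorem shift_pow {K : Type*} [Field K] {A : ℤ → K} {m : ℕ} {ε : K}
    (h : ∀ i : ℤ, ε * A i = A (i - m)) (k : ℕ) (i : ℤ) : ε ^ k * A i = A (i - k * m) := by
  induction k with
  | zero => simp
  | succ k ih =>
    rw [pow_succ', mul_assoc, ih, h]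
    congr 1
    push_cast
    ring

theorem isConeSeq_of_reduced {K : Type*} [Field K] {σ σ' : K →+* ℝ} {A : ℤ → K} {b : ℤ → ℤ}
    {m : ℕ} {ε : K} (hm : 0 < m) (hb2 : ∀ i, 2 ≤ b i)
    (hArec : ∀ i : ℤ, A (i + 1) = (b i : K) * A i - A (i - 1)) (hA0 : A 0 = 1)
    (h2 : 1 < σ (A (-1))) (h0 : 0 < σ' (A (-1))) (h1 : σ' (A (-1)) < 1)
    (hε1 : 1 < σ ε) (hε' : 0 < σ' ε) (hshift : ∀ i : ℤ, ε * A i = A (i - m)) :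
    IsConeSeq σ σ' A b m ε := by
  have hb2' : ∀ i, (2:ℝ) ≤ b i := fun i => by exact_mod_cast hb2 i
  have hdet : ∀ i, σ (A (i - 1)) * σ' (A i) - σ (A i) * σ' (A (i - 1)) =
      σ (A (-1)) - σ' (A (-1)) := by
    have step : ∀ i, σ (A (i + 1 - 1)) * σ' (A (i + 1)) - σ (A (i + 1)) * σ' (A (i + 1 - 1)) =
        σ (A (i - 1)) * σ' (A i) - σ (A i) * σ' (A (i - 1)) := by
      intro i
      rw [add_sub_cancel_right, hArec i]
      simp only [map_sub, map_mul, map_intCast]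
      ring
    intro i
    induction i using Int.induction_on with
    | zero => simp [hA0]
    | succ i ih => rw [step, ih]
    | pred i ih => rw [← ih, ← step, sub_add_cancel]
  have left : ∀ n : ℕ, 0 < σ (A (-n)) := by
    intro n
    refine (pos_and_lt_succ (u := fun n : ℕ => σ (A (-n))) (c := fun n => b (-(n + 1)))
      (fun n => hb2' _) ?_ ?_ ?_ n).1
    · simp [hA0]
    · simpa [hA0] using h2
    · intro n
      have h := congrArg σ (hArec (-(n + 1)))
      simp only [map_sub, map_mul, map_intCast] at h
      have e1 : (-((n:ℤ) + 1) + 1) = -n := by ring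
      have e2 : (-((n:ℤ) + 1) - 1) = -((n + 2 : ℕ) : ℤ) := by push_cast; ring
      have e3 : (-((n:ℤ) + 1)) = -((n + 1 : ℕ) : ℤ) := by push_cast; ring
      rw [e1, e2, e3] at h
      simp only [e3]
      linarith
  have right : ∀ n : ℕ, 0 < σ' (A (n - 1)) := by
    intro n
    refine (pos_and_lt_succ (u := fun n : ℕ => σ' (A (n - 1))) (c := fun n => b n)
      (fun n => hb2' _) ?_ ?_ ?_ n).1
    · simpa using h0
    · simpa [hA0] using h1
    · intro n
      have h := congrArg σ' (hArec n)
      simp only [map_sub, map_mul, map_intCast] at h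
      have e1 : ((n + 2 : ℕ) : ℤ) - 1 = n + 1 := by push_cast; ring
      have e2 : ((n + 1 : ℕ) : ℤ) - 1 = n := by push_cast; ring
      simp only [e1, e2]
      exact h
  refine ⟨hm, hArec, fun i => ?_, fun i => ?_, fun i => ?_, hshift, hε1, ?_⟩
  · have h := congrArg σ (shift_pow hshift i.toNat i)
    obtain ⟨n, hn⟩ : ∃ n : ℕ, i - i.toNat * m = -n := by
      refine ⟨(i.toNat * m - i).toNat, ?_⟩
      have h1 : i ≤ i.toNat := Int.self_le_toNat i
      have h2 : (i.toNat : ℤ) ≤ i.toNat * m := by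
        have : (1:ℤ) ≤ m := by exact_mod_cast hm
        nlinarith [Int.natCast_nonneg i.toNat]
      omega
    rw [hn, map_mul, map_pow] at h
    have h3 := left n
    rw [← h] at h3
    exact pos_of_mul_pos_right h3 (by positivity)
  · have h := congrArg σ' (shift_pow hshift (-i).toNat (i + (-i).toNat * m))
    rw [add_sub_cancel_right, map_mul, map_pow] at h
    obtain ⟨n, hn⟩ : ∃ n : ℕ, i + (-i).toNat * m = n - 1 := by
      refine ⟨(i + (-i).toNat * m + 1).toNat, ?_⟩
      have h1 : -i ≤ (-i).toNat := Int.self_le_toNat (-i)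
      have h2 : ((-i).toNat : ℤ) ≤ (-i).toNat * m := by
        have : (1:ℤ) ≤ m := by exact_mod_cast hm
        nlinarith [Int.natCast_nonneg (-i).toNat]
      omega
    rw [hn] at h
    rw [← h]
    exact mul_pos (pow_pos hε' _) (right n)
  · rw [hdet]; linarith
  · have h := hdet (0 - m)
    have e : (0:ℤ) - m - 1 = 0 - 1 - m := by ring
    rw [e, ← hshift, ← hshift] at h
    have h0 := hdet 0
    simp only [map_mul] at h
    have h3 : (σ ε * σ' ε - 1) * (σ (A (-1)) - σ' (A (-1))) = 0 := by
      rw [← h0]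
      linear_combination h - h0
    rcases mul_eq_zero.1 h3 with h4 | h4 <;> linarith

namespace IsConeSeq

variable {K : Type*} [Field K] {σ σ' : K →+* ℝ} {A : ℤ → K} {b : ℤ → ℤ} {m : ℕ} {ε : K}

theorem shift_zpow (h : IsConeSeq σ σ' A b m ε) (k i : ℤ) : ε ^ k * A i = A (i - k * m) := by
  have hε : ε ≠ 0 := by rintro rfl; simpa using h.norm_eq
  obtain ⟨n, rfl | rfl⟩ := k.eq_nat_or_neg
  · simpa using shift_pow h.shift n i
  · have := shift_pow h.shift n (i - -n * m)
    rw [zpow_neg, zpow_natCast, inv_mul_eq_iff_eq_mul₀ (pow_ne_zero _ hε), this]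
    congr 1
    ring

/-- The oriented area spanned by `α` and `A i`. -/
def side (σ σ' : K →+* ℝ) (A : ℤ → K) (α : K) (i : ℤ) : ℝ := σ α * σ' (A i) - σ' α * σ (A i)

/-- `α` lies in the half-open cone spanned by `A (i - 1)` and `A i`. -/
def InCone (σ σ' : K →+* ℝ) (A : ℤ → K) (α : K) (i : ℤ) : Prop :=
  side σ σ' A α (i - 1) ≤ 0 ∧ 0 < side σ σ' A α i

theorem norm_zpow (h : IsConeSeq σ σ' A b m ε) (k : ℤ) : σ (ε ^ k) * σ' (ε ^ k) = 1 := by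
  rw [map_zpow₀, map_zpow₀, ← mul_zpow, h.norm_eq, one_zpow]

theorem side_zpow (h : IsConeSeq σ σ' A b m ε) (α : K) (k i : ℤ) :
    side σ σ' A (ε ^ k * α) (i - k * m) = side σ σ' A α i := by
  rw [side, side, ← h.shift_zpow]
  simp only [map_mul]
  linear_combination (σ α * σ' (A i) - σ' α * σ (A i)) * h.norm_zpow k

theorem inCone_zpow (h : IsConeSeq σ σ' A b m ε) {α : K} {i : ℤ} (hα : InCone σ σ' A α i)
    (k : ℤ) : InCone σ σ' A (ε ^ k * α) (i - k * m) := by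
  have e : i - k * m - 1 = i - 1 - k * m := by ring
  rw [InCone, e, h.side_zpow, h.side_zpow]
  exact hα

theorem inCone_iff (h : IsConeSeq σ σ' A b m ε) {α : K} {i : ℤ} {x y : ℝ}
    (h1 : x * σ (A (i - 1)) + y * σ (A i) = σ α) (h2 : x * σ' (A (i - 1)) + y * σ' (A i) = σ' α) :
    InCone σ σ' A α i ↔ 0 < x ∧ 0 ≤ y := by
  have hd := h.det_pos i
  have e1 : side σ σ' A α i = x * (σ (A (i - 1)) * σ' (A i) - σ (A i) * σ' (A (i - 1))) := by
    rw [side, ← h1, ← h2]; ring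
  have e2 : side σ σ' A α (i - 1) =
      -(y * (σ (A (i - 1)) * σ' (A i) - σ (A i) * σ' (A (i - 1)))) := by
    rw [side, ← h1, ← h2]; ring
  rw [InCone, e1, e2, neg_nonpos, mul_nonneg_iff_of_pos_right hd, mul_pos_iff_of_pos_right hd,
    and_comm]

theorem coord_eq (h : IsConeSeq σ σ' A b m ε) {i : ℤ} {x y x' y' : ℝ}
    (h1 : x * σ (A (i - 1)) + y * σ (A i) = x' * σ (A (i - 1)) + y' * σ (A i))
    (h2 : x * σ' (A (i - 1)) + y * σ' (A i) = x' * σ' (A (i - 1)) + y' * σ' (A i)) :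
    x = x' ∧ y = y' := by
  have hd := (h.det_pos i).ne'
  constructor
  · exact mul_right_cancel₀ hd (by linear_combination σ' (A i) * h1 - σ (A i) * h2)
  · exact mul_right_cancel₀ hd
      (by linear_combination σ (A (i - 1)) * h2 - σ' (A (i - 1)) * h1)

theorem strictMono_slope (h : IsConeSeq σ σ' A b m ε) :
    StrictMono fun i => σ' (A i) / σ (A i) := by
  refine strictMono_int_of_lt_succ fun i => ?_
  rw [div_lt_div_iff₀ (h.pos _) (h.pos _)]
  have := h.det_pos (i + 1)
  rw [add_sub_cancel_right] at this
  linarith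

theorem side_pos_iff (h : IsConeSeq σ σ' A b m ε) {α : K} (hα : 0 < σ α) (i : ℤ) :
    0 < side σ σ' A α i ↔ σ' α / σ α < σ' (A i) / σ (A i) := by
  rw [div_lt_div_iff₀ hα (h.pos i), side, sub_pos, mul_comm (σ α)]

theorem inCone_unique (h : IsConeSeq σ σ' A b m ε) {α : K} (hα : 0 < σ α) {i j : ℤ}
    (hi : InCone σ σ' A α i) (hj : InCone σ σ' A α j) : i = j := by
  have key : ∀ {i j}, InCone σ σ' A α i → InCone σ σ' A α j → ¬ i < j := by
    intro i j hi hj hij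
    have h1 := (h.side_pos_iff hα i).1 hi.2
    have h2 : ¬ 0 < side σ σ' A α (j - 1) := not_lt.2 hj.1
    rw [h.side_pos_iff hα] at h2
    exact h2 (h1.trans_le (h.strictMono_slope.monotone (by omega)))
  exact le_antisymm (not_lt.1 (key hj hi)) (not_lt.1 (key hi hj))

theorem slope_shift (h : IsConeSeq σ σ' A b m ε) (k i : ℤ) :
    σ' (A (i - k * m)) / σ (A (i - k * m)) = (σ ε ^ 2) ^ (-k) * (σ' (A i) / σ (A i)) := by
  have hε : 0 < σ ε := zero_lt_one.trans h.one_lt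
  have e : σ' ε = (σ ε)⁻¹ := eq_inv_of_mul_eq_one_right h.norm_eq
  rw [← h.shift_zpow, map_mul, map_mul, map_zpow₀, map_zpow₀, e, inv_zpow, zpow_neg]
  have := (h.pos i).ne'
  have := (zpow_pos hε k).ne'
  have e2 : (σ ε ^ 2) ^ k = (σ ε ^ k) ^ 2 := by
    rw [← zpow_natCast, ← zpow_natCast, ← zpow_mul, ← zpow_mul, mul_comm]
  rw [e2]
  field_simp

theorem exists_inCone (h : IsConeSeq σ σ' A b m ε) {α : K} (hα : 0 < σ α) (hα' : 0 < σ' α) :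
    ∃ i, InCone σ σ' A α i := by
  have hε : 1 < σ ε ^ 2 := one_lt_pow₀ h.one_lt two_ne_zero
  have hρ : 0 < σ' (A 0) / σ (A 0) := div_pos (h.pos' 0) (h.pos 0)
  have hs : 0 < σ' α / σ α := div_pos hα' hα
  obtain ⟨n, hn⟩ := pow_unbounded_of_one_lt (σ' α / σ α / (σ' (A 0) / σ (A 0))) hε
  obtain ⟨l, hl⟩ := pow_unbounded_of_one_lt (σ' (A 0) / σ (A 0) / (σ' α / σ α)) hε
  rw [div_lt_iff₀ hρ] at hn
  rw [div_lt_iff₀ hs] at hl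
  have hl0 : (0:ℝ) < (σ ε ^ 2) ^ l := by have := hε; positivity
  have hbdd : ∀ i, 0 < side σ σ' A α i → 0 - (l : ℤ) * m ≤ i := by
    intro i hi
    by_contra! hlt
    have h1 := (h.side_pos_iff hα i).1 hi
    have h2 := h.strictMono_slope hlt
    simp only at h2
    rw [h.slope_shift, zpow_neg, zpow_natCast] at h2
    have h3 := h1.trans h2
    rw [lt_inv_mul_iff₀ hl0] at h3
    linarith
  have hne : 0 < side σ σ' A α (0 - (-(n : ℤ)) * m) := by
    rw [h.side_pos_iff hα, h.slope_shift, neg_neg, zpow_natCast]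
    exact hn
  obtain ⟨i, hi, hmin⟩ := Int.exists_least_of_bdd ⟨_, hbdd⟩ ⟨_, hne⟩
  refine ⟨i, not_lt.1 fun h' => ?_, hi⟩
  have := hmin _ h'
  omega

end IsConeSeq

/-- The points `z i` of the coset `c + M` with coordinates `X i ∈ (0, 1]`, `Y i ∈ [0, 1)` with
respect to the basis `A (i - 1)`, `A i` of `M`, where `ε ^ lam` preserves the coset. -/
structure IsConeCover {K : Type*} [Field K] (σ σ' : K →+* ℝ) (A : ℤ → K) (b : ℤ → ℤ) (m : ℕ)
    (ε : K) (M : AddSubgroup K) (c : K) (lam : ℕ) (z : ℤ → K) (X Y : ℤ → ℝ) : Prop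
    extends IsConeSeq σ σ' A b m ε where
  basis : ∀ i w, w ∈ M ↔ ∃ u v : ℤ, w = u * A (i - 1) + v * A i
  mem_Ioc : ∀ i, X i ∈ Set.Ioc (0:ℝ) 1
  mem_Ico : ∀ i, Y i ∈ Set.Ico (0:ℝ) 1
  sub_mem : ∀ i, z i - c ∈ M
  coord : ∀ i, X i * σ (A (i - 1)) + Y i * σ (A i) = σ (z i)
  coord' : ∀ i, X i * σ' (A (i - 1)) + Y i * σ' (A i) = σ' (z i)
  lam_pos : 0 < lam
  zpow_mem : ∀ (t : ℤ) (w : K), w - c ∈ M → ε ^ ((lam : ℤ) * t) * w - c ∈ M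

namespace IsConeCover

variable {K : Type*} [Field K] {σ σ' : K →+* ℝ} {A : ℤ → K} {b : ℤ → ℤ} {m : ℕ} {ε : K}
  {M : AddSubgroup K} {c : K} {lam : ℕ} {z : ℤ → K} {X Y : ℤ → ℝ}

/-- The lattice points of the cone spanned by `A (i - 1)` and `A i`. -/
def point (A z : ℤ → K) (i : ℤ) (j : ℕ × ℕ) : K := z i + j.1 * A (i - 1) + j.2 * A i

theorem coord_point (h : IsConeCover σ σ' A b m ε M c lam z X Y) (i : ℤ) (j : ℕ × ℕ) :
    (X i + j.1) * σ (A (i - 1)) + (Y i + j.2) * σ (A i) = σ (point A z i j) := by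
  simp only [point, map_add, map_mul, map_natCast, ← h.coord]
  ring

theorem coord_point' (h : IsConeCover σ σ' A b m ε M c lam z X Y) (i : ℤ) (j : ℕ × ℕ) :
    (X i + j.1) * σ' (A (i - 1)) + (Y i + j.2) * σ' (A i) = σ' (point A z i j) := by
  simp only [point, map_add, map_mul, map_natCast, ← h.coord']
  ring

theorem point_sub_mem (h : IsConeCover σ σ' A b m ε M c lam z X Y) (i : ℤ) (j : ℕ × ℕ) :
    point A z i j - c ∈ M := by
  have e : point A z i j - c = (z i - c) + (j.1 * A (i - 1) + j.2 * A i) := by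
    rw [point]; ring
  rw [e]
  exact M.add_mem (h.sub_mem i) ((h.basis i _).2 ⟨j.1, j.2, by push_cast; rfl⟩)

theorem inCone_point (h : IsConeCover σ σ' A b m ε M c lam z X Y) (i : ℤ) (j : ℕ × ℕ) :
    IsConeSeq.InCone σ σ' A (point A z i j) i := by
  rw [h.inCone_iff (h.coord_point i j) (h.coord_point' i j)]
  have h1 := (h.mem_Ioc i).1
  have h2 := (h.mem_Ico i).1
  constructor <;> positivity

theorem point_pos (h : IsConeCover σ σ' A b m ε M c lam z X Y) (i : ℤ) (j : ℕ × ℕ) :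
    0 < σ (point A z i j) := by
  rw [← h.coord_point]
  have h1 := (h.mem_Ioc i).1
  have h2 := (h.mem_Ico i).1
  have := h.pos i
  have := h.pos (i - 1)
  positivity

theorem point_pos' (h : IsConeCover σ σ' A b m ε M c lam z X Y) (i : ℤ) (j : ℕ × ℕ) :
    0 < σ' (point A z i j) := by
  rw [← h.coord_point']
  have h1 := (h.mem_Ioc i).1
  have h2 := (h.mem_Ico i).1
  have := h.pos' i
  have := h.pos' (i - 1)
  positivity

theorem point_injective (h : IsConeCover σ σ' A b m ε M c lam z X Y) {i i' : ℤ} {j j' : ℕ × ℕ}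
    (hp : point A z i j = point A z i' j') : i = i' ∧ j = j' := by
  have hi : i = i' := h.inCone_unique (h.point_pos i j) (h.inCone_point i j)
    (hp ▸ h.inCone_point i' j')
  subst hi
  refine ⟨rfl, ?_⟩
  obtain ⟨h1, h2⟩ := h.coord_eq
    ((h.coord_point i j).trans ((congrArg σ hp).trans (h.coord_point i j').symm))
    ((h.coord_point' i j).trans ((congrArg σ' hp).trans (h.coord_point' i j').symm))
  refine Prod.ext ?_ ?_
  · exact_mod_cast add_left_cancel h1
  · exact_mod_cast add_left_cancel h2

theorem exists_point (h : IsConeCover σ σ' A b m ε M c lam z X Y) {α : K} {i : ℤ}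
    (hα : α - c ∈ M) (hi : IsConeSeq.InCone σ σ' A α i) : ∃ j, α = point A z i j := by
  have h1 : α - z i ∈ M := by
    have := M.sub_mem hα (h.sub_mem i)
    rwa [sub_sub_sub_cancel_right] at this
  obtain ⟨u, v, huv⟩ := (h.basis i _).1 h1
  have e : α = z i + (u * A (i - 1) + v * A i) := by rw [← huv]; ring
  have e1 : (X i + u) * σ (A (i - 1)) + (Y i + v) * σ (A i) = σ α := by
    rw [e]; simp only [map_add, map_mul, map_intCast, ← h.coord]; ring
  have e2 : (X i + u) * σ' (A (i - 1)) + (Y i + v) * σ' (A i) = σ' α := by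
    rw [e]; simp only [map_add, map_mul, map_intCast, ← h.coord']; ring
  obtain ⟨hx, hy⟩ := (h.inCone_iff e1 e2).1 hi
  have hu : (-1:ℤ) < u := by
    have : (-1:ℝ) < u := by linarith [(h.mem_Ioc i).2]
    exact_mod_cast this
  have hv : (-1:ℤ) < v := by
    have : (-1:ℝ) < v := by linarith [(h.mem_Ico i).2]
    exact_mod_cast this
  lift u to ℕ using by omega
  lift v to ℕ using by omega
  refine ⟨(u, v), ?_⟩
  rw [e, point]
  push_cast
  ring

theorem add_eq_one (h : IsConeCover σ σ' A b m ε M c lam z X Y) (i : ℤ) :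
    X i + Y (i + 1) = 1 := by
  have h1 : z i - z (i + 1) ∈ M := by
    have := M.sub_mem (h.sub_mem i) (h.sub_mem (i + 1))
    rwa [sub_sub_sub_cancel_right] at this
  obtain ⟨u, v, huv⟩ := (h.basis (i + 1) _).1 h1
  have c1 := h.coord i
  have c1' := h.coord' i
  have c2 := h.coord (i + 1)
  have c2' := h.coord' (i + 1)
  have r := congrArg σ (h.add_one i)
  have r' := congrArg σ' (h.add_one i)
  have s := congrArg σ huv
  have s' := congrArg σ' huv
  simp only [map_add, map_sub, map_mul, map_intCast] at r r' s s'
  obtain ⟨-, e⟩ := h.coord_eq (i := i + 1) (x := X i * b i + Y i) (y := -X i)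
    (x' := X (i + 1) + u) (y' := Y (i + 1) + v)
    (by
      rw [add_sub_cancel_right] at c2 s ⊢
      linear_combination c1 - c2 + s - X i * r)
    (by
      rw [add_sub_cancel_right] at c2' s' ⊢
      linear_combination c1' - c2' + s' - X i * r')
  have e' : X i + Y (i + 1) = ((-v : ℤ) : ℝ) := by push_cast; linarith
  have b1 := h.mem_Ioc i
  have b2 := h.mem_Ico (i + 1)
  have l1 : (0:ℝ) < ((-v : ℤ) : ℝ) := by rw [← e']; linarith [b1.1, b2.1]
  have l2 : ((-v : ℤ) : ℝ) < 2 := by rw [← e']; linarith [b1.2, b2.2]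
  have l1' : 0 < -v := by exact_mod_cast l1
  have l2' : -v < 2 := by exact_mod_cast l2
  rw [e', show -v = 1 by omega]
  norm_num

theorem X_period (h : IsConeCover σ σ' A b m ε M c lam z X Y) (i : ℤ) :
    X (i + lam * m) = X i := by
  have hz := h.zpow_mem 1 _ (h.sub_mem (i + lam * m))
  have h1 : ε ^ ((lam : ℤ) * 1) * z (i + lam * m) - z i ∈ M := by
    have := M.sub_mem hz (h.sub_mem i)
    rwa [sub_sub_sub_cancel_right] at this
  rw [mul_one] at h1
  obtain ⟨u, v, huv⟩ := (h.basis i _).1 h1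
  have p1 := h.shift_zpow lam (i + lam * m)
  have p2 := h.shift_zpow lam (i + lam * m - 1)
  rw [show i + (lam : ℤ) * m - lam * m = i by ring] at p1
  rw [show i + (lam : ℤ) * m - 1 - lam * m = i - 1 by ring] at p2
  have c1 := h.coord (i + lam * m)
  have c1' := h.coord' (i + lam * m)
  have c2 := h.coord i
  have c2' := h.coord' i
  have r := congrArg σ p1
  have r' := congrArg σ' p1
  have t := congrArg σ p2
  have t' := congrArg σ' p2
  have s := congrArg σ huv
  have s' := congrArg σ' huv
  simp only [map_add, map_sub, map_mul, map_intCast] at r r' s s' t t'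
  obtain ⟨e, -⟩ := h.coord_eq (i := i) (x := X (i + lam * m)) (y := Y (i + lam * m))
    (x' := X i + u) (y' := Y i + v)
    (by linear_combination σ (ε ^ (lam : ℤ)) * c1 - c2 + s - X (i + lam * m) * t
          - Y (i + lam * m) * r)
    (by linear_combination σ' (ε ^ (lam : ℤ)) * c1' - c2' + s' - X (i + lam * m) * t'
          - Y (i + lam * m) * r')
  have b1 := h.mem_Ioc i
  have b2 := h.mem_Ioc (i + lam * m)
  have l1 : (-1:ℝ) < u := by linarith [b1.2, b2.1]
  have l2 : (u:ℝ) < 1 := by linarith [b1.1, b2.2]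
  have l1' : -1 < u := by exact_mod_cast l1
  have l2' : u < 1 := by exact_mod_cast l2
  rw [e, show u = 0 by omega]
  simp

theorem exists_equiv (h : IsConeCover σ σ' A b m ε M c lam z X Y) {R : Set K}
    (hRsub : ∀ α ∈ R, α - c ∈ M ∧ 0 < σ α ∧ 0 < σ' α)
    (hRrep : ∀ α : K, α - c ∈ M ∧ 0 < σ α ∧ 0 < σ' α →
      ∃! β : K, β ∈ R ∧ ∃ t : ℤ, α = ε ^ ((lam : ℤ) * t) * β) :
    ∃ Φ : (Finset.Icc (1:ℤ) (lam * m)) × (ℕ × ℕ) ≃ R, ∀ i j,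
      σ (Φ (i, j)) * σ' (Φ (i, j)) =
        ((X i + j.1) * σ (A (i - 1)) + (Y i + j.2) * σ (A i)) *
          ((X i + j.1) * σ' (A (i - 1)) + (Y i + j.2) * σ' (A i)) := by
  have hε : ε ≠ 0 := by rintro rfl; simpa using h.norm_eq
  have hlm : (0:ℤ) < lam * m := mul_pos (by exact_mod_cast h.lam_pos) (by exact_mod_cast h.m_pos)
  have ex : ∀ p : (Finset.Icc (1:ℤ) (lam * m)) × (ℕ × ℕ), ∃ β : R, ∃ t : ℤ,
      point A z p.1 p.2 = ε ^ ((lam : ℤ) * t) * β := by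
    intro p
    obtain ⟨β, ⟨h1, h2⟩, -⟩ := hRrep _
      ⟨h.point_sub_mem p.1 p.2, h.point_pos p.1 p.2, h.point_pos' p.1 p.2⟩
    exact ⟨⟨β, h1⟩, h2⟩
  choose Φ t hΦ using ex
  have hbij : Function.Bijective Φ := by
    constructor
    · intro p p' hpp
      have e1 : (Φ p : K) = ε ^ ((lam : ℤ) * -t p) * point A z p.1 p.2 := by
        rw [hΦ p, ← mul_assoc, ← zpow_add₀ hε]
        simp
      have e2 : point A z p'.1 p'.2 =
          ε ^ ((lam : ℤ) * (t p' - t p)) * point A z p.1 p.2 := by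
        rw [hΦ p', ← hpp, e1, ← mul_assoc, ← zpow_add₀ hε]
        ring_nf
      have hc := h.inCone_zpow (h.inCone_point p.1 p.2) ((lam : ℤ) * (t p' - t p))
      rw [← e2] at hc
      have hi := h.inCone_unique (h.point_pos p'.1 p'.2) hc (h.inCone_point p'.1 p'.2)
      have b1 := Finset.mem_Icc.1 p.1.2
      have b2 := Finset.mem_Icc.1 p'.1.2
      have ht : t p' - t p = 0 := by
        have e3 : (lam : ℤ) * (t p' - t p) * m = (lam * m) * (t p' - t p) := by ring
        rw [e3] at hi
        by_contra hne
        rcases lt_or_gt_of_ne hne with h0 | h0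
        · have : (lam : ℤ) * m * (t p' - t p) ≤ lam * m * (-1) :=
            mul_le_mul_of_nonneg_left (by omega) hlm.le
          omega
        · have : (lam : ℤ) * m * 1 ≤ lam * m * (t p' - t p) :=
            mul_le_mul_of_nonneg_left (by omega) hlm.le
          omega
      rw [ht] at e2
      simp only [mul_zero, zpow_zero, one_mul] at e2
      obtain ⟨f1, f2⟩ := h.point_injective e2
      exact (Prod.ext (Subtype.ext f1) f2).symm
    · rintro ⟨β, hβ⟩
      obtain ⟨g1, g2, g3⟩ := hRsub β hβ
      obtain ⟨i, hi⟩ := h.exists_inCone g2 g3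
      have hc := h.inCone_zpow hi ((lam : ℤ) * ((i - 1) / (lam * m)))
      have e3 : i - (lam : ℤ) * ((i - 1) / (lam * m)) * m = 1 + (i - 1) % (lam * m) := by
        have := Int.mul_ediv_add_emod (i - 1) (lam * m)
        linarith
      rw [e3] at hc
      obtain ⟨j, hj⟩ := h.exists_point (h.zpow_mem ((i - 1) / (lam * m)) _ g1) hc
      have m1 := Int.emod_nonneg (i - 1) hlm.ne'
      have m2 := Int.emod_lt_of_pos (i - 1) hlm
      set p : (Finset.Icc (1:ℤ) (lam * m)) × (ℕ × ℕ) :=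
        (⟨1 + (i - 1) % (lam * m), Finset.mem_Icc.2 ⟨by omega, by omega⟩⟩, j) with hp
      refine ⟨p, ?_⟩
      refine Subtype.ext ((hRrep _ ⟨h.point_sub_mem _ j, h.point_pos _ j,
        h.point_pos' _ j⟩).unique ⟨Subtype.coe_prop _, _, hΦ p⟩ ⟨hβ, _, hj.symm⟩)
  refine ⟨Equiv.ofBijective Φ hbij, fun i j => ?_⟩
  rw [h.coord_point, h.coord_point', hΦ (i, j), Equiv.ofBijective_apply, map_mul, map_mul]
  linear_combination -(σ (Φ (i, j)) * σ' (Φ (i, j))) * h.norm_zpow ((lam : ℤ) * t (i, j))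

theorem sum_Icc_sub_one (f : ℤ → ℝ) (n : ℕ) (hf : f n = f 0) :
    ∑ i ∈ Finset.Icc (1:ℤ) n, f (i - 1) = ∑ i ∈ Finset.Icc (1:ℤ) n, f i := by
  have key : ∀ n : ℕ, ∑ i ∈ Finset.Icc (1:ℤ) n, f (i - 1) + f n =
      ∑ i ∈ Finset.Icc (1:ℤ) n, f i + f 0 := by
    intro n
    induction n with
    | zero => simp
    | succ n ih =>
      have e : Finset.Icc (1:ℤ) ((n + 1 : ℕ) : ℤ) =
          insert ((n + 1 : ℕ) : ℤ) (Finset.Icc 1 (n : ℤ)) := by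
        ext x; simp only [Finset.mem_Icc, Finset.mem_insert]; push_cast; omega
      rw [e, Finset.sum_insert (by simp), Finset.sum_insert (by simp)]
      have e2 : ((n + 1 : ℕ) : ℤ) - 1 = n := by push_cast; ring
      rw [e2]
      linarith
  have := key n
  linarith

theorem B2_one_sub (x : ℝ) : B2 (1 - x) = B2 x := by
  simp only [B2]; ring

theorem sum_cone_values (h : IsConeCover σ σ' A b m ε M c lam z X Y) :
    ∑ i ∈ Finset.Icc (1:ℤ) (lam * m), (4 * (B1 (X i) * B1 (Y i)) +
      B2 (X i) * (σ (A (i - 1)) / σ (A i) + σ' (A (i - 1)) / σ' (A i)) +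
      B2 (Y i) * (σ (A i) / σ (A (i - 1)) + σ' (A i) / σ' (A (i - 1)))) =
    4 * ∑ i ∈ Finset.Icc (1:ℤ) (lam * m),
      (B1 (X i) * B1 (Y i) + (b i : ℝ) / 2 * B2 (X i)) := by
  have hY : ∀ i, B2 (Y i) = B2 (X (i - 1)) := by
    intro i
    have := h.add_eq_one (i - 1)
    rw [sub_add_cancel] at this
    rw [← B2_one_sub (X (i - 1))]
    congr 1
    linarith
  set t : ℤ → ℝ := fun i => B2 (X i) * (σ (A (i + 1)) / σ (A i) + σ' (A (i + 1)) / σ' (A i))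
    with ht
  have hε0 : σ ε ≠ 0 := left_ne_zero_of_mul_eq_one h.norm_eq
  have hε0' : σ' ε ≠ 0 := right_ne_zero_of_mul_eq_one h.norm_eq
  have htp : t ((lam * m : ℕ) : ℤ) = t 0 := by
    have e1 := h.X_period 0
    have p1 := h.shift_zpow lam (0 + lam * m)
    have p2 := h.shift_zpow lam (1 + lam * m)
    rw [add_sub_cancel_right] at p1 p2
    have n1 : σ (ε ^ (lam : ℤ)) ≠ 0 := by rw [map_zpow₀]; exact zpow_ne_zero _ hε0
    have n2 : σ' (ε ^ (lam : ℤ)) ≠ 0 := by rw [map_zpow₀]; exact zpow_ne_zero _ hε0'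
    simp only [ht]
    push_cast
    rw [zero_add] at e1 p1
    rw [e1, ← p1, ← p2, add_comm (1:ℤ), map_mul, map_mul, map_mul, map_mul,
      mul_div_mul_left _ _ n1, mul_div_mul_left _ _ n2]
  have hs := sum_Icc_sub_one t (lam * m) htp
  push_cast at hs
  have e : ∀ i, 4 * (B1 (X i) * B1 (Y i)) +
      B2 (X i) * (σ (A (i - 1)) / σ (A i) + σ' (A (i - 1)) / σ' (A i)) +
      B2 (Y i) * (σ (A i) / σ (A (i - 1)) + σ' (A i) / σ' (A (i - 1))) =
      (4 * (B1 (X i) * B1 (Y i)) +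
      B2 (X i) * (σ (A (i - 1)) / σ (A i) + σ' (A (i - 1)) / σ' (A i))) + t (i - 1) := by
    intro i
    simp only [ht, hY, sub_add_cancel]
  simp only [e]
  rw [Finset.sum_add_distrib, hs, ← Finset.sum_add_distrib, Finset.mul_sum]
  refine Finset.sum_congr rfl fun i _ => ?_
  have n1 := (h.pos i).ne'
  have n2 := (h.pos' i).ne'
  simp only [ht, h.add_one i, map_sub, map_mul, map_intCast]
  field_simp
  ring

end IsConeCover

theorem hasSum_fintype_prod {ι κ : Type*} [Fintype ι] [DecidableEq ι] {f : ι → κ → ℂ} {v : ι → ℂ}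
    (h : ∀ i, HasSum (f i) (v i)) : HasSum (fun p : ι × κ => f p.1 p.2) (∑ i, v i) := by
  have h1 : ∀ i, HasSum (fun p : ι × κ => if p.1 = i then f p.1 p.2 else 0) (v i) := by
    intro i
    have hinj : Function.Injective (fun k : κ => (i, k)) := fun k k' e => (Prod.ext_iff.1 e).2
    refine (hinj.hasSum_iff ?_).1 ?_
    · rintro ⟨i', k⟩ hp
      refine if_neg fun e => hp ?_
      subst e
      exact ⟨k, rfl⟩
    · simpa [Function.comp_def] using h i
  have h2 := hasSum_sum (s := Finset.univ) fun i _ => h1 i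
  simpa using h2

theorem Gamma_two_mul_add_one {s : ℂ} (h0 : s ≠ 0) (h1 : 2 * s - 1 ≠ 0) (h2 : 2 * s - 2 ≠ 0) :
    Complex.Gamma (2 * s + 1) =
      2 * s * ((2 * s - 1) * ((2 * s - 2) * Complex.Gamma (2 * s - 2))) := by
  rw [Complex.Gamma_add_one _ (mul_ne_zero two_ne_zero h0), ← Complex.Gamma_add_one _ h2,
    show 2 * s - 2 + 1 = 2 * s - 1 by ring, ← Complex.Gamma_add_one _ h1,
    show 2 * s - 1 + 1 = 2 * s by ring]

theorem value_at_zero_of_eq {E F : ℂ → ℂ} (hE : Differentiable ℂ E) {U : Set ℂ} (hU : IsOpen U)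
    (hU' : IsConnected U) (hsub : {s : ℂ | 1 < s.re} ∪ {0} ⊆ U) (hF : AnalyticOnNhd ℂ F U)
    (h : ∀ s : ℂ, 1 < s.re → F s = E s * (Complex.Gamma (2 * s - 2) / Complex.Gamma s)) :
    4 * F 0 = E 0 := by
  have h2 : (2:ℂ) ∈ U := hsub (Or.inl (by simp))
  have key := eqOn_of_eq_of_one_lt_re hU hU'.isPreconnected h2
    (f := fun s => F s * (2 * ((2 * s - 2) * (2 * s - 1))) * (Complex.Gamma (2 * s + 1))⁻¹)
    (g := fun s => E s * (Complex.Gamma (s + 1))⁻¹) ?_ ?_ ?_ (hsub (Or.inr rfl))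
  · simp only [mul_zero, zero_add, Complex.Gamma_one, inv_one, mul_one] at key
    rw [← key]
    ring
  · refine (hF.differentiableOn.mul (by fun_prop)).mul (Differentiable.differentiableOn ?_)
    exact Complex.differentiable_one_div_Gamma.comp (f := fun s : ℂ => 2 * s + 1) (by fun_prop)
  · refine (hE.mul ?_).differentiableOn
    exact Complex.differentiable_one_div_Gamma.comp (f := fun s : ℂ => s + 1) (by fun_prop)
  · intro s hs
    have ne_of : ∀ {w : ℂ}, 0 < w.re → w ≠ 0 := fun {w} hw e => by simp [e] at hw
    have n0 : s ≠ 0 := ne_of (by linarith)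
    have n1 : 2 * s - 1 ≠ 0 := ne_of (by simp; linarith)
    have n2' : 0 < (2 * s - 2).re := by simp; linarith
    have n2 : 2 * s - 2 ≠ 0 := ne_of n2'
    have g1 := Complex.Gamma_ne_zero_of_re_pos (s := s) (by linarith)
    have g2 := Complex.Gamma_ne_zero_of_re_pos n2'
    rw [h s hs, Gamma_two_mul_add_one n0 n1 n2, Complex.Gamma_add_one s n0]
    generalize Complex.Gamma (2 * s - 2) = G at g2 ⊢
    generalize 2 * s - 2 = w2 at n2 ⊢
    generalize 2 * s - 1 = w1 at n1 ⊢
    field_simp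

namespace IsConeCover

variable {K : Type*} [Field K] {σ σ' : K →+* ℝ} {A : ℤ → K} {b : ℤ → ℤ} {m : ℕ} {ε : K}
  {M : AddSubgroup K} {c : K} {lam : ℕ} {z : ℤ → K} {X Y : ℤ → ℝ}

theorem exists_zeta (h : IsConeCover σ σ' A b m ε M c lam z X Y) {R : Set K}
    (hRsub : ∀ α ∈ R, α - c ∈ M ∧ 0 < σ α ∧ 0 < σ' α)
    (hRrep : ∀ α : K, α - c ∈ M ∧ 0 < σ α ∧ 0 < σ' α →
      ∃! β : K, β ∈ R ∧ ∃ t : ℤ, α = ε ^ ((lam : ℤ) * t) * β) :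
    ∃ E : ℂ → ℂ, Differentiable ℂ E ∧
      E 0 = 4 * ((∑ i ∈ Finset.Icc (1:ℤ) (lam * m),
        (B1 (X i) * B1 (Y i) + (b i : ℝ) / 2 * B2 (X i)) : ℝ) : ℂ) ∧
      ∀ s : ℂ, 1 < s.re → HasSum (fun α : R => ((σ (α : K) * σ' (α : K) : ℝ) : ℂ) ^ (-s))
        (E s * (Complex.Gamma (2 * s - 2) / Complex.Gamma s)) := by
  have cone : ∀ i, _ := fun i => exists_cone_zeta (h.pos (i - 1)) (h.pos' (i - 1)) (h.pos i)
    (h.pos' i) (h.mem_Ioc i).1 (h.mem_Ico i).1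
  choose E hE hE0 hEs using cone
  refine ⟨fun s => ∑ i ∈ Finset.Icc (1:ℤ) (lam * m), E i s, by fun_prop, ?_, fun s hs => ?_⟩
  · simp only [hE0]
    rw [← Complex.ofReal_sum, h.sum_cone_values]
    push_cast
    rfl
  · obtain ⟨Φ, hΦ⟩ := h.exists_equiv hRsub hRrep
    rw [← Φ.hasSum_iff, Finset.sum_mul, ← Finset.sum_coe_sort]
    have := hasSum_fintype_prod fun i : Finset.Icc (1:ℤ) (lam * m) => hEs i s hs
    refine this.congr_fun fun p => ?_
    rw [Function.comp_apply, hΦ p.1 p.2]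

end IsConeCover

/-- The powers of a unit `ε` which are `1` modulo `q` are the multiples of the least positive
one. -/
theorem zpow_eq_one_add_mul_iff {O : Type*} [CommRing O] {q : O} {ε : Oˣ} {lam : ℕ}
    (hlam : IsLeast {l : ℕ | 0 < l ∧ ∃ y : O, (ε : O) ^ l = 1 + q * y} lam) (j : ℤ) :
    (∃ y : O, ((ε ^ j : Oˣ) : O) = 1 + q * y) ↔ (lam : ℤ) ∣ j := by
  set π := Units.map (Ideal.Quotient.mk (Ideal.span {q})).toMonoidHom with hπ
  have key : ∀ u : Oˣ, (∃ y : O, (u : O) = 1 + q * y) ↔ π u = 1 := by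
    intro u
    rw [Units.ext_iff]
    change _ ↔ Ideal.Quotient.mk (Ideal.span {q}) (u : O) = 1
    rw [← map_one (Ideal.Quotient.mk (Ideal.span {q})), Ideal.Quotient.eq,
      Ideal.mem_span_singleton, dvd_def]
    simp only [sub_eq_iff_eq_add']
  have hord : orderOf (π ε) = lam := by
    rw [orderOf_eq_iff hlam.1.1]
    constructor
    · rw [← map_pow, ← key, Units.val_pow_eq_pow_val]
      exact hlam.1.2
    · intro l hl hl0 h
      rw [← map_pow, ← key, Units.val_pow_eq_pow_val] at h
      exact absurd (hlam.2 ⟨hl0, h⟩) (not_le.2 hl)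
  rw [key, map_zpow, ← orderOf_dvd_iff_zpow_eq_one, hord]

end ConeZeta

/-- Shintani's evaluation (the combination of (2.9) and Lemma 2.8 of Jun–Lee): for
`λ = [E⁺ : E_q⁺]` (encoded as the least `l > 0` with `ε^l ≡ 1 (mod qO_K)` for the
totally positive fundamental unit `ε`), and `R` a set of representatives of the orbits of
`E_q⁺` on `((C+Dδ)/q + 𝔟⁻¹)⁺`, the series `Z(s) = Σ_{α∈R} N(α)^{-s}` converges absolutely
for `Re(s) > 1` and every analytic continuation `F` of it to a connected open set
containing the half plane and `0` satisfies
`F(0) = Σ_{i=1}^{λm} [B₁(x^i)B₁(y^i) + (b_i/2)B₂(x^i)]`. -/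
theorem stmt_8 {K : Type*} [Field K] [NumberField K]
    (hdeg : Module.finrank ℚ K = 2)
    (σ σ' : K →+* ℝ) (hσσ' : σ ≠ σ')
    (q : ℕ) (hq : 0 < q)
    (𝔟 : Ideal (𝓞 K)) (hbcop : IsCoprime 𝔟 (Ideal.span {(q : 𝓞 K)}))
    (δ : K) (hδ2 : 2 < σ δ) (hδ'0 : 0 < σ' δ) (hδ'1 : σ' δ < 1)
    (hbinv : ∀ z : K,
      z ∈ ((𝔟 : FractionalIdeal (𝓞 K)⁰ K))⁻¹ ↔ ∃ a b : ℤ, z = (a : K) + (b : K) * δ)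
    -- the minus continued fraction data
    (m : ℕ) (hm : 0 < m)
    (b : ℤ → ℤ) (hb2 : ∀ i, 2 ≤ b i) (hbper : ∀ i, b (i + m) = b i)
    (δseq : ℤ → K) (hδ0 : δseq 0 = δ) (hδne : ∀ i, δseq i ≠ 0)
    (hδrec : ∀ i, δseq i = (b i : K) - 1 / δseq (i+1)) (hδper : ∀ i, δseq (i + m) = δseq i)
    (A : ℤ → K) (hAm1 : A (-1) = δ) (hA0 : A 0 = 1)
    (hArec : ∀ i : ℤ, A (i+1) = (b i : K) * A i - A (i-1))
    (hAbasis : ∀ i : ℤ, ∀ z : K,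
      z ∈ ((𝔟 : FractionalIdeal (𝓞 K)⁰ K))⁻¹ ↔ ∃ u v : ℤ, z = (u : K) * A (i-1) + (v : K) * A i)
    -- the totally positive fundamental unit `ε > 1`
    (ε : (𝓞 K)ˣ) (hεpos : 0 < σ ((ε : 𝓞 K) : K) ∧ 0 < σ' ((ε : 𝓞 K) : K))
    (hε1 : 1 < σ ((ε : 𝓞 K) : K))
    (hεfund : ∀ u : (𝓞 K)ˣ, 0 < σ ((u : 𝓞 K) : K) → 0 < σ' ((u : 𝓞 K) : K) →
      ∃ j : ℤ, ((u : 𝓞 K) : K) = (((ε : 𝓞 K) : K)) ^ j)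
    (hshift : ∀ i : ℤ, ((ε : 𝓞 K) : K) * A i = A (i - m))
    -- `λ = [E⁺ : E_q⁺]`
    (lam : ℕ)
    (hlam : IsLeast {l : ℕ | 0 < l ∧ ∃ y : 𝓞 K, ((ε : 𝓞 K)) ^ l = 1 + (q : 𝓞 K) * y} lam)
    -- the pairs `(x^i_{C+Dδ}, y^i_{C+Dδ})`
    (X Y : ℤ → ℤ → ℤ → ℝ)
    (hXY : ∀ C D i : ℤ, X C D i ∈ Set.Ioc (0:ℝ) 1 ∧ Y C D i ∈ Set.Ico (0:ℝ) 1 ∧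
      ∃ z : K, (z - ((C : K) + (D : K) * δ) / (q : K)) ∈ ((𝔟 : FractionalIdeal (𝓞 K)⁰ K))⁻¹ ∧
        X C D i * σ (A (i-1)) + Y C D i * σ (A i) = σ z ∧
        X C D i * σ' (A (i-1)) + Y C D i * σ' (A i) = σ' z)
    (C D : ℤ) (hC : 0 ≤ C) (hCq : C ≤ (q:ℤ) - 1) (hD : 0 ≤ D) (hDq : D ≤ (q:ℤ) - 1)
    (hCD : ¬ (C = 0 ∧ D = 0))
    -- `R`: representatives of the orbits of `E_q⁺` acting on `((C+Dδ)/q + 𝔟⁻¹)⁺`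
    (R : Set K)
    (hRsub : ∀ α ∈ R, (α - ((C : K) + (D : K) * δ) / (q : K))
        ∈ ((𝔟 : FractionalIdeal (𝓞 K)⁰ K))⁻¹ ∧ 0 < σ α ∧ 0 < σ' α)
    (hRrep : ∀ α : K,
      ((α - ((C : K) + (D : K) * δ) / (q : K)) ∈ ((𝔟 : FractionalIdeal (𝓞 K)⁰ K))⁻¹
        ∧ 0 < σ α ∧ 0 < σ' α) →
      ∃! β : K, β ∈ R ∧ ∃ u : (𝓞 K)ˣ, (0 < σ ((u : 𝓞 K) : K) ∧ 0 < σ' ((u : 𝓞 K) : K)) ∧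
        (∃ y : 𝓞 K, (u : 𝓞 K) = 1 + (q : 𝓞 K) * y) ∧ α = ((u : 𝓞 K) : K) * β) :
    (∀ s : ℂ, 1 < s.re →
      Summable (fun α : R => ‖((σ (α : K) * σ' (α : K) : ℝ) : ℂ) ^ (-s)‖)) ∧
    (∀ (U : Set ℂ) (F : ℂ → ℂ), IsOpen U → IsConnected U →
      ({s : ℂ | 1 < s.re} ∪ {0}) ⊆ U → AnalyticOnNhd ℂ F U →
      (∀ s ∈ {s : ℂ | 1 < s.re},
        F s = ∑' α : R, ((σ (α : K) * σ' (α : K) : ℝ) : ℂ) ^ (-s)) →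
      F 0 = ((∑ i ∈ Finset.Icc (1:ℤ) ((lam : ℤ) * m),
        (B1 (X C D i) * B1 (Y C D i) + (b i : ℝ)/2 * B2 (X C D i)) : ℝ) : ℂ)) := by
  classical
  have hq0 : (q : K) ≠ 0 := by exact_mod_cast hq.ne'
  have hcoe : ∀ j : ℤ, (((ε ^ j : (𝓞 K)ˣ) : 𝓞 K) : K) = ((ε : 𝓞 K) : K) ^ j :=
    fun j => NumberField.Units.coe_zpow ε j
  have hseq : ConeZeta.IsConeSeq σ σ' A b m ((ε : 𝓞 K) : K) :=
    ConeZeta.isConeSeq_of_reduced hm hb2 hArec hA0 (by rw [hAm1]; linarith) (by rwa [hAm1])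
      (by rwa [hAm1]) hε1 hεpos.2 hshift
  choose hX hY z hz hz1 hz2 using hXY C D
  set I : Submodule (𝓞 K) K := ((((𝔟 : FractionalIdeal (𝓞 K)⁰ K))⁻¹ : FractionalIdeal (𝓞 K)⁰ K) :
    Submodule (𝓞 K) K) with hI
  have hmem : ∀ w : K, w ∈ I ↔ w ∈ ((𝔟 : FractionalIdeal (𝓞 K)⁰ K))⁻¹ :=
    fun w => FractionalIdeal.mem_coe
  set c : K := ((C : K) + (D : K) * δ) / (q : K) with hc
  have hcover : ConeZeta.IsConeCover σ σ' A b m ((ε : 𝓞 K) : K) I.toAddSubgroup c lam z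
      (X C D) (Y C D) := by
    refine ⟨hseq, fun i w => (hmem w).trans (hAbasis i w), hX, hY, fun i => (hmem _).2 (hz i),
      hz1, hz2, hlam.1.1, fun t w hw => ?_⟩
    obtain ⟨y, hy⟩ := (ConeZeta.zpow_eq_one_add_mul_iff hlam (lam * t)).2 (dvd_mul_right _ t)
    have hy' := congrArg (fun x : 𝓞 K => (x : K)) hy
    simp only [hcoe] at hy'
    have e : ((ε : 𝓞 K) : K) ^ ((lam : ℤ) * t) * w - c =
        (ε ^ ((lam : ℤ) * t) : (𝓞 K)ˣ) • (w - c) + y • ((C : K) + (D : K) * δ) := by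
      rw [Units.smul_def, Algebra.smul_def, Algebra.smul_def]
      change _ = (((ε ^ ((lam : ℤ) * t) : (𝓞 K)ˣ) : 𝓞 K) : K) * (w - c) + (y : K) * _
      rw [hcoe, hy', hc]
      push_cast
      field_simp
      ring
    change _ ∈ I
    rw [e]
    refine I.add_mem (I.smul_mem _ hw) (I.smul_mem _ ?_)
    exact (hmem _).2 ((hbinv _).2 ⟨C, D, rfl⟩)
  have horb : ∀ α β : K, (∃ u : (𝓞 K)ˣ, (0 < σ ((u : 𝓞 K) : K) ∧ 0 < σ' ((u : 𝓞 K) : K)) ∧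
      (∃ y : 𝓞 K, (u : 𝓞 K) = 1 + (q : 𝓞 K) * y) ∧ α = ((u : 𝓞 K) : K) * β) ↔
      ∃ t : ℤ, α = ((ε : 𝓞 K) : K) ^ ((lam : ℤ) * t) * β := by
    intro α β
    constructor
    · rintro ⟨u, ⟨h1, h2⟩, hy, rfl⟩
      obtain ⟨j, hj⟩ := hεfund u h1 h2
      rw [← hcoe] at hj
      have hu : u = ε ^ j := NumberField.Units.coe_injective K hj
      rw [hu, ConeZeta.zpow_eq_one_add_mul_iff hlam] at hy
      obtain ⟨t, rfl⟩ := hy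
      exact ⟨t, by rw [hu, hcoe]⟩
    · rintro ⟨t, ht⟩
      refine ⟨ε ^ ((lam : ℤ) * t), ?_,
        (ConeZeta.zpow_eq_one_add_mul_iff hlam _).2 (dvd_mul_right _ t), ?_⟩
      · rw [hcoe, map_zpow₀, map_zpow₀]
        exact ⟨zpow_pos hεpos.1 _, zpow_pos hεpos.2 _⟩
      · rw [hcoe]; exact ht
  simp only [horb] at hRrep
  obtain ⟨E, hE, hE0, hEs⟩ := hcover.exists_zeta hRsub hRrep
  refine ⟨fun s hs => (hEs s hs).summable.norm, fun U F hU hU' hsub hF hFs => ?_⟩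
  have h4 := ConeZeta.value_at_zero_of_eq hE hU hU' hsub hF
    fun s hs => (hFs s hs).trans (hEs s hs).tsum_eq
  rw [hE0] at h4
  exact mul_left_cancel₀ (by norm_num) h4
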